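/- Let G be a 2-connected graph with at least 6 vertices and minimum degree at least 3. Then G contains a cycle whose length is congruent to 2 modulo 4. -/

import Mathlib

open SimpleGraph

/-- `G` has a cycle of length `n`. -/
def HasCycleLen {V : Type*} (G : SimpleGraph V) (n : ℕ) : Prop :=
  ∃ (v : V) (c : G.Walk v v), c.IsCycle ∧ c.length = n

/-- `G` is `t`-connected: it has at least `t+1` vertices and the deletion of any set
of at most `t-1` vertices leaves a connected graph. -/
def KConnected {V : Type*} [Fintype V] (G : SimpleGraph V) (t : ℕ) : Prop :=
  t + 1 ≤ Fintype.card V ∧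
    ∀ S : Finset V, S.card ≤ t - 1 → (G.induce ((↑S : Set V)ᶜ)).Connected

section Paths

variable {V : Type*} {G H : SimpleGraph V} {S T : Set V} {a b c : V} {k l : ℕ}

/-- The vertices `f lo, …, f hi` form a path in `G`. -/
structure IsPathOn (G : SimpleGraph V) (f : ℕ → V) (lo hi : ℕ) : Prop where
  injOn : Set.InjOn f (Set.Icc lo hi)
  adj : ∀ j, lo ≤ j → j < hi → G.Adj (f j) (f (j + 1))

theorem IsPathOn.mono {f : ℕ → V} {i i' j j' : ℕ} (hf : IsPathOn G f i j) (hi : i ≤ i')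
    (hj : j' ≤ j) : IsPathOn G f i' j' :=
  ⟨hf.injOn.mono (Set.Icc_subset_Icc hi hj), fun k h h' => hf.adj k (hi.trans h) (h'.trans_le hj)⟩

/-- `G` has a path of length `n` from `a` to `b` inside `S`. -/
def HasPathIn (G : SimpleGraph V) (S : Set V) (a b : V) (n : ℕ) : Prop :=
  ∃ p : G.Walk a b, p.IsPath ∧ p.length = n ∧ ∀ x ∈ p.support, x ∈ S

namespace HasPathIn

theorem refl (ha : a ∈ S) : HasPathIn G S a a 0 :=
  ⟨.nil, by simp, rfl, by simpa using ha⟩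

theorem mono (h : HasPathIn G S a b k) (hGH : G ≤ H) (hST : S ⊆ T) : HasPathIn H T a b k := by
  obtain ⟨p, hp, hl, hs⟩ := h
  exact ⟨p.mapLe hGH, hp.mapLe hGH, by simpa using hl, fun x hx => hST (hs x (by simpa using hx))⟩

theorem subset (h : HasPathIn G S a b k) (hST : S ⊆ T) : HasPathIn G T a b k :=
  h.mono le_rfl hST

theorem symm (h : HasPathIn G S a b k) : HasPathIn G S b a k := by
  obtain ⟨p, hp, hl, hs⟩ := h
  exact ⟨p.reverse, hp.reverse, by simpa using hl, fun x hx => hs x (by simpa using hx)⟩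

theorem left_mem (h : HasPathIn G S a b k) : a ∈ S := by
  obtain ⟨p, -, -, hs⟩ := h
  exact hs a p.start_mem_support

theorem append (h : HasPathIn G S a b k) (h' : HasPathIn G T b c l)
    (hST : ∀ x ∈ S, x ∈ T → x = b) : HasPathIn G (S ∪ T) a c (k + l) := by
  obtain ⟨p, hp, hl, hs⟩ := h
  obtain ⟨q, hq, hl', hs'⟩ := h'
  refine ⟨p.append q, ?_, by simp [hl, hl'], fun x hx => ?_⟩
  · rw [Walk.isPath_def, Walk.support_append, List.nodup_append']
    refine ⟨hp.support_nodup, hq.support_nodup.tail, fun x hx hx' => ?_⟩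
    have := hST x (hs x hx) (hs' x (List.mem_of_mem_tail hx'))
    subst this
    have := hq.support_nodup
    rw [← Walk.cons_tail_support] at this
    exact (List.nodup_cons.1 this).1 hx'
  · rcases (Walk.mem_support_append_iff p q).1 hx with h | h
    · exact Or.inl (hs x h)
    · exact Or.inr (hs' x h)

theorem of_adj (h : G.Adj a b) : HasPathIn G {a, b} a b 1 :=
  ⟨h.toWalk, by simp [h.ne], by simp, by simp⟩

theorem cons (h : G.Adj a b) (h' : HasPathIn G T b c l) (ha : a ∉ T) :
    HasPathIn G (insert a T) a c (l + 1) := by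
  have := (of_adj h).append h' (by rintro x (rfl | rfl) hx; exacts [absurd hx ha, rfl])
  rw [add_comm] at this
  refine this.subset ?_
  rintro x ((rfl | rfl) | hx)
  exacts [Or.inl rfl, Or.inr h'.left_mem, Or.inr hx]

theorem concat (h' : HasPathIn G T a b l) (h : G.Adj b c) (hc : c ∉ T) :
    HasPathIn G (insert c T) a c (l + 1) :=
  (h'.symm.cons h.symm hc).symm

/-- A path closed up by an edge is a cycle. -/
theorem hasCycleLen (h : HasPathIn G S a b k) (hab : G.Adj a b) (hk : k ≠ 1) :
    HasCycleLen G (k + 1) := by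
  obtain ⟨p, hp, hl, -⟩ := h
  refine ⟨b, .cons hab.symm p, (Walk.cons_isCycle_iff p hab.symm).2 ⟨hp, fun he => hk ?_⟩,
    by simp [hl]⟩
  rw [Sym2.eq_swap] at he
  rw [← hl]
  cases p with
  | nil => exact absurd rfl hab.ne
  | cons h q =>
    rw [Walk.cons_isPath_iff] at hp
    rw [Walk.edges_cons, List.mem_cons] at he
    rcases he with he | he
    · obtain ⟨-, rfl⟩ | ⟨rfl, -⟩ := Sym2.eq_iff.1 he
      swap
      · exact absurd rfl h.ne
      simp [Walk.length_eq_zero_iff.2 (Walk.isPath_iff_nil.1 hp.1)]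
    · exact absurd (q.fst_mem_support_of_mem_edges he) hp.2

theorem segment {f : ℕ → V} {i j : ℕ} (hf : IsPathOn G f i j) (hij : i ≤ j) :
    HasPathIn G (f '' Set.Icc i j) (f i) (f j) (j - i) := by
  induction j, hij using Nat.le_induction with
  | base => simpa using refl (by simp)
  | succ j hij ih =>
    have := (ih ⟨hf.injOn.mono (Set.Icc_subset_Icc_right (by lia)),
      fun k h h' => hf.adj k h (by lia)⟩).concat (hf.adj j hij (by lia)) (by
        rintro ⟨k, ⟨hk, hk'⟩, he⟩
        have := hf.injOn (⟨hk, by lia⟩ : k ∈ Set.Icc i (j + 1)) ⟨by lia, le_rfl⟩ he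
        lia)
    rw [show j + 1 - i = j - i + 1 by lia]
    refine this.subset ?_
    rintro x (rfl | ⟨k, ⟨hk, hk'⟩, rfl⟩)
    exacts [⟨j + 1, ⟨by lia, le_rfl⟩, rfl⟩, ⟨k, ⟨hk, by lia⟩, rfl⟩]

end HasPathIn

end Paths

namespace PathSearch

section Definitions

/-! The functions below are written with recursors, so that the kernel evaluates them quickly. -/

/-- Membership of `x` in `l`. -/
noncomputable def memb (x : ℕ) (l : List ℕ) : Bool :=
  List.rec false (fun y _ ih => Bool.rec ih true (Nat.beq x y)) l

/-- Whether some pair in `l` satisfies `f`. -/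
noncomputable def anyPair (f : ℕ → ℕ → Bool) (l : List (ℕ × ℕ)) : Bool :=
  List.rec false (fun w _ ih => Prod.rec (fun i j => Bool.rec ih true (f i j)) w) l

/-- `k n`, evaluating `n` first. -/
noncomputable def forceNat (k : ℕ → Bool) (n : ℕ) : Bool :=
  Nat.rec (k 0) (fun m _ => k (Nat.succ m)) n

/-- `k l`, evaluating `l` first. -/
noncomputable def forceList (l : List (ℕ × ℕ)) : (List (ℕ × ℕ) → Bool) → Bool :=
  List.rec (fun k => k []) (fun w _ ih k => Prod.rec (fun i d =>
    forceNat (fun i => forceNat (fun d => ih fun l => k ((i, d) :: l)) d) i) w) l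

/-- `k l`, evaluating `l` first. -/
noncomputable def forceLists (l : List (List (ℕ × ℕ))) : (List (List (ℕ × ℕ)) → Bool) → Bool :=
  List.rec (fun k => k []) (fun w _ ih k => forceList w fun w => ih fun l => k (w :: l)) l

/-- The entry of `l` at `i`. -/
noncomputable def entry (l : List (List (ℕ × ℕ))) (i : ℕ) : List (ℕ × ℕ) :=
  List.rec (fun _ => []) (fun a _ ih i => Nat.rec a (fun j _ => ih j) i) l i

/-- Index of the first class containing `x`, counted from `i`. -/
noncomputable def classOf (x : ℕ) (cs : List (List ℕ)) : ℕ → Option ℕ :=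
  List.rec (fun _ => none) (fun c _ ih i => Bool.rec (ih (Nat.succ i)) (some i) (memb x c)) cs

/-- The class indices of those label pairs in `l` whose labels both occur in `cs`. -/
noncomputable def resolve (cs : List (List ℕ)) (l : List (ℕ × ℕ)) : List (ℕ × ℕ) :=
  List.rec [] (fun w _ ih => Prod.rec (fun a b =>
    Option.rec ih (fun i => Option.rec ih (fun j => (i, j) :: ih) (classOf b cs 0))
      (classOf a cs 0)) w) l

/-- The pairs in `l` containing `x`. -/
noncomputable def relevant (x : ℕ) (l : List (ℕ × ℕ)) : List (ℕ × ℕ) :=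
  List.rec [] (fun w _ ih => Prod.rec (fun a b =>
    Bool.rec (Bool.rec ih ((a, b) :: ih) (Nat.beq b x)) ((a, b) :: ih) (Nat.beq a x)) w) l

/-- The pairs in `E` other than `(a, b)` and `(b, a)`. -/
noncomputable def without (a b : ℕ) (E : List (ℕ × ℕ)) : List (ℕ × ℕ) :=
  List.rec [] (fun w _ ih => Prod.rec (fun i j =>
    Bool.rec (Bool.rec ((i, j) :: ih) (Bool.rec ((i, j) :: ih) ih (Nat.beq i b)) (Nat.beq j a))
      (Bool.rec ((i, j) :: ih) ih (Nat.beq j b)) (Nat.beq i a)) w) E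

/-- The moves (target and length) along a chord from class `i`. -/
noncomputable def chordMoves (i : ℕ) (E : List (ℕ × ℕ)) : List (ℕ × ℕ) :=
  List.rec [] (fun w _ ih => Prod.rec (fun a b =>
    Bool.rec (Bool.rec ih ((a, 1) :: ih) (Nat.beq i b)) ((b, 1) :: ih) (Nat.beq i a)) w) E

/-- The moves from the classes `i, i + 1, …`, where `ds` are the gaps between these classes and
`left` adds the move from class `i` to the left. -/
noncomputable def moves (E : List (ℕ × ℕ)) (ds : List ℕ) :
    ℕ → (List (ℕ × ℕ) → List (ℕ × ℕ)) → List (List (ℕ × ℕ)) :=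
  List.rec (fun i left => [left (chordMoves i E)])
    (fun d _ ih i left => left ((Nat.succ i, d) :: chordMoves i E) ::
      ih (Nat.succ i) fun l => (i, d) :: l) ds

/-- Depth-first search for a path to `a` whose length is `t` mod 4. -/
noncomputable def reach (adj : List (List (ℕ × ℕ))) (a t n : ℕ) : ℕ → List ℕ → ℕ → Bool :=
  Nat.rec (fun _ _ _ => false) (fun _ ih cur vis len =>
    Bool.rec (anyPair (fun w d => Bool.rec (ih w (w :: vis) (Nat.add len d)) false (memb w vis))
      (entry adj cur)) (Nat.beq (Nat.mod len 4) t) (Nat.beq cur a)) n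

/-- Whether the gap at index `i` is `1`. -/
def gapOne : List ℕ → ℕ → Bool
  | [], _ => false
  | d :: _, 0 => Nat.beq d 1
  | _ :: ds, i + 1 => gapOne ds i

/-- All ways to insert the label `x` into an ordered list of classes `cs` with gaps `ds` mod 4. -/
def ins (x : ℕ) : List (List ℕ) → List ℕ → List (List (List ℕ) × List ℕ)
  | [], _ => []
  | c :: cs, [] => [((x :: c) :: cs, [])]
  | c :: cs, d :: ds =>
    ((x :: c) :: cs, d :: ds) ::
      ([0, 1, 2, 3].map (fun e => (c :: [x] :: cs, e :: ((d + 4 - e) % 4) :: ds)) ++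
        (ins x cs ds).map (fun r => (c :: r.1, d :: r.2)))

/-- Labels `0, 1, …` stand for positions along a path, labels `0` and `1` for its ends. The lists
contain pairs of labels whose positions are ends of a chord (`chords`), are not joined by a path of
given residue mod 4 (`virt`), are consecutive (`succ`), distinct (`neq`) or increasing (`lt`). -/
structure Problem where
  chords : List (ℕ × ℕ)
  virt : List (ℕ × ℕ × ℕ) := []
  succ : List (ℕ × ℕ) := []
  neq : List (ℕ × ℕ) := []
  lt : List (ℕ × ℕ) := []

/-- Whether an arrangement of labels is impossible. -/
noncomputable def bad (p : Problem) (x : ℕ) (cs : List (List ℕ)) (ds : List ℕ) : Bool :=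
  anyPair (fun i j => !(Nat.beq j (i + 1) && gapOne ds i)) (resolve cs p.succ) ||
  anyPair (fun i j => Nat.beq i j) (resolve cs (relevant x p.neq)) ||
  anyPair (fun i j => Nat.ble j i) (resolve cs (relevant x p.lt)) ||
  anyPair (fun i j => Nat.beq i j) (resolve cs (relevant x p.chords)) ||
  anyPair (fun i j => forceLists (moves (without i j (resolve cs p.chords)) ds 0 fun l => l)
    fun adj => reach adj i 1 cs.length j [j] 0) (resolve cs (relevant x p.chords)) ||
  p.virt.any fun v => anyPair (fun i j => forceLists (moves (resolve cs p.chords) ds 0 fun l => l)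
    fun adj => reach adj i v.2.2 cs.length j [j] 0) (resolve cs [(v.1, v.2.1)])

/-- Whether inserting the labels `xs` one by one leads to impossible arrangements only. -/
noncomputable def search (p : Problem) : List ℕ → List (List ℕ) → List ℕ → Bool
  | [], _, _ => false
  | x :: xs, cs, ds => (ins x cs ds).all fun r => bad p x r.1 r.2 || search p xs r.1 r.2

/-- Whether the labels `0, 1` and `xs` can only be arranged in impossible ways. -/
noncomputable def refute (p : Problem) (xs : List ℕ) : Bool :=
  [0, 1, 2, 3].all fun d => bad p 0 [[0], [1]] [d] || search p xs [[0], [1]] [d]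

end Definitions

section Evaluation

variable {a b i j x d : ℕ} {E l : List (ℕ × ℕ)} {cs : List (List ℕ)} {ds : List ℕ}

theorem memb_iff {l : List ℕ} : memb x l = true ↔ x ∈ l := by
  induction l with
  | nil => simp [memb]
  | cons y l ih =>
    change Bool.rec (memb x l) true (Nat.beq x y) = true ↔ _
    rw [List.mem_cons, ← ih, ← Nat.beq_eq]
    cases Nat.beq x y <;> simp

theorem anyPair_iff {f : ℕ → ℕ → Bool} : anyPair f l = true ↔ ∃ i j, (i, j) ∈ l ∧ f i j = true := by
  induction l with
  | nil => simp [anyPair]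
  | cons w l ih =>
    obtain ⟨a, b⟩ := w
    change Bool.rec (anyPair f l) true (f a b) = true ↔ _
    cases h : f a b <;> simp only [ih] <;> grind

theorem forceNat_eq (k : ℕ → Bool) (n : ℕ) : forceNat k n = k n := by
  cases n <;> rfl

theorem forceList_eq (k : List (ℕ × ℕ) → Bool) : forceList l k = k l := by
  induction l generalizing k with
  | nil => rfl
  | cons w l ih =>
    change forceNat (fun i => forceNat (fun d => forceList l fun l => k ((i, d) :: l)) w.2) w.1 = _
    simp [forceNat_eq, ih]

theorem forceLists_eq {l : List (List (ℕ × ℕ))} (k : List (List (ℕ × ℕ)) → Bool) :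
    forceLists l k = k l := by
  induction l generalizing k with
  | nil => rfl
  | cons w l ih =>
    change forceList w (fun w => forceLists l fun l => k (w :: l)) = _
    simp [forceList_eq, ih]

theorem classOf_spec {i₀ : ℕ} (h : classOf x cs i₀ = some i) :
    ∃ j c, i = i₀ + j ∧ cs[j]? = some c ∧ x ∈ c := by
  induction cs generalizing i₀ with
  | nil => cases h
  | cons c cs ih =>
    change Bool.rec (classOf x cs (i₀ + 1)) (some i₀) (memb x c) = some i at h
    cases hx : memb x c <;> simp only [hx] at h
    · obtain ⟨j, c', rfl, h', hx'⟩ := ih h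
      exact ⟨j + 1, c', by lia, by simpa using h', hx'⟩
    · exact ⟨0, c, by simpa using h.symm, rfl, memb_iff.1 hx⟩

theorem resolve_spec (h : (i, j) ∈ resolve cs l) : ∃ a b, (a, b) ∈ l ∧
    (∃ c, cs[i]? = some c ∧ a ∈ c) ∧ ∃ c, cs[j]? = some c ∧ b ∈ c := by
  induction l with
  | nil => cases h
  | cons w l ih =>
    obtain ⟨a, b⟩ := w
    change (i, j) ∈ (Option.rec (resolve cs l) (fun i => Option.rec (resolve cs l)
      (fun j => (i, j) :: resolve cs l) (classOf b cs 0)) (classOf a cs 0) :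
        List (ℕ × ℕ)) at h
    cases ha : classOf a cs 0 <;> cases hb : classOf b cs 0 <;> simp only [ha, hb] at h
    case some.some i' j' =>
      rcases List.mem_cons.1 h with h | h
      · obtain ⟨rfl, rfl⟩ := Prod.mk.inj h
        obtain ⟨i', c, hi, hc⟩ := classOf_spec ha
        obtain ⟨j', c', hj, hc'⟩ := classOf_spec hb
        refine ⟨a, b, by simp, ⟨c, ?_⟩, ⟨c', ?_⟩⟩
        · simpa [show i = i' by simpa using hi] using hc
        · simpa [show j = j' by simpa using hj] using hc'
      · obtain ⟨a', b', h', hh⟩ := ih h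
        exact ⟨a', b', List.mem_cons_of_mem _ h', hh⟩
    all_goals
      obtain ⟨a', b', h', hh⟩ := ih h
      exact ⟨a', b', List.mem_cons_of_mem _ h', hh⟩

theorem mem_of_mem_relevant (h : (i, j) ∈ relevant x l) : (i, j) ∈ l := by
  induction l with
  | nil => exact h
  | cons w l ih =>
    obtain ⟨a, b⟩ := w
    change (i, j) ∈ (Bool.rec (Bool.rec (relevant x l) ((a, b) :: relevant x l) (Nat.beq b x))
      ((a, b) :: relevant x l) (Nat.beq a x) : List (ℕ × ℕ)) at h
    cases ha : Nat.beq a x <;> cases hb : Nat.beq b x <;> simp only [ha, hb] at h <;> grind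

theorem mem_without (h : (i, j) ∈ without a b E) :
    (i, j) ∈ E ∧ ¬ (i = a ∧ j = b) ∧ ¬ (i = b ∧ j = a) := by
  induction E with
  | nil => cases h
  | cons w E ih =>
    obtain ⟨p, q⟩ := w
    change (i, j) ∈ (Bool.rec (Bool.rec ((p, q) :: without a b E)
      (Bool.rec ((p, q) :: without a b E) (without a b E) (Nat.beq p b)) (Nat.beq q a))
      (Bool.rec ((p, q) :: without a b E) (without a b E) (Nat.beq q b)) (Nat.beq p a) :
        List (ℕ × ℕ)) at h
    have h1 := Nat.beq_eq (x := p) (y := a)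
    have h2 := Nat.beq_eq (x := p) (y := b)
    have h3 := Nat.beq_eq (x := q) (y := a)
    have h4 := Nat.beq_eq (x := q) (y := b)
    cases h1' : Nat.beq p a <;> cases h2' : Nat.beq p b <;> cases h3' : Nat.beq q a <;>
      cases h4' : Nat.beq q b <;> simp only [h1', h2', h3', h4'] at h h1 h2 h3 h4 <;> grind

theorem mem_chordMoves (h : (j, d) ∈ chordMoves i E) : d = 1 ∧ ((i, j) ∈ E ∨ (j, i) ∈ E) := by
  induction E with
  | nil => cases h
  | cons w E ih =>
    obtain ⟨a, b⟩ := w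
    change (j, d) ∈ (Bool.rec (Bool.rec (chordMoves i E) ((a, 1) :: chordMoves i E) (Nat.beq i b))
      ((b, 1) :: chordMoves i E) (Nat.beq i a) : List (ℕ × ℕ)) at h
    have h1 := Nat.beq_eq (x := i) (y := a)
    have h2 := Nat.beq_eq (x := i) (y := b)
    cases h1' : Nat.beq i a <;> cases h2' : Nat.beq i b <;>
      simp only [h1', h2'] at h h1 h2 <;> grind

theorem mem_entry_moves {k : ℕ} {left : List (ℕ × ℕ) → List (ℕ × ℕ)}
    (h : (j, d) ∈ entry (moves E ds i left) k) :
    (k = 0 ∧ ∃ l, (j, d) ∈ left l ∧ (j, d) ∉ l) ∨ (j = i + k + 1 ∧ ds[k]? = some d) ∨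
      (∃ m, k = m + 1 ∧ j = i + m ∧ ds[m]? = some d) ∨
      d = 1 ∧ ((i + k, j) ∈ E ∨ (j, i + k) ∈ E) := by
  induction ds generalizing i k left with
  | nil =>
    cases k with
    | succ k => cases h
    | zero =>
      change _ ∈ left (chordMoves i E) at h
      by_cases h' : (j, d) ∈ chordMoves i E
      · exact Or.inr (Or.inr (Or.inr (mem_chordMoves h')))
      · exact Or.inl ⟨rfl, _, h, h'⟩
  | cons e ds ih =>
    cases k with
    | zero =>
      change _ ∈ left ((i + 1, e) :: chordMoves i E) at h
      by_cases h' : (j, d) ∈ (i + 1, e) :: chordMoves i E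
      · rcases List.mem_cons.1 h' with h' | h'
        · obtain ⟨rfl, rfl⟩ := Prod.mk.inj h'
          exact Or.inr (Or.inl ⟨rfl, rfl⟩)
        · exact Or.inr (Or.inr (Or.inr (mem_chordMoves h')))
      · exact Or.inl ⟨rfl, _, h, h'⟩
    | succ k =>
      change _ ∈ entry (moves E ds (i + 1) fun l => (i, e) :: l) k at h
      rcases ih h with ⟨rfl, l, hl, hl'⟩ | ⟨h1, h2⟩ | ⟨m, rfl, h1, h2⟩ | h'
      · have : (j, d) = (i, e) := by grind
        obtain ⟨rfl, rfl⟩ := Prod.mk.inj this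
        exact Or.inr (Or.inr (Or.inl ⟨0, rfl, rfl, rfl⟩))
      · exact Or.inr (Or.inl ⟨by lia, by simpa using h2⟩)
      · exact Or.inr (Or.inr (Or.inl ⟨m + 1, rfl, by lia, by simpa using h2⟩))
      · rw [show i + 1 + k = i + (k + 1) by lia] at h'
        exact Or.inr (Or.inr (Or.inr h'))

theorem gapOne_iff : gapOne ds i = true ↔ ds[i]? = some 1 := by
  induction ds generalizing i with
  | nil => simp [gapOne]
  | cons e ds ih => cases i <;> simp [gapOne, ih]

end Evaluation
section Soundness

variable {V : Type*} {G : SimpleGraph V} {f : ℕ → V} {lo hi : ℕ}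

/-- The positions that a search which has visited the classes `vis` may no longer use. -/
def Used (P : ℕ → ℕ) (vis : List ℕ) (j : ℕ) : Prop :=
  (∃ i ∈ vis, j = P i) ∨ ∃ i ∈ vis, i + 1 ∈ vis ∧ P i < j ∧ j < P (i + 1)

theorem not_used {P : ℕ → ℕ} (hP : StrictMono P) {vis : List ℕ} {w : ℕ} (hw : w ∉ vis) :
    ¬ Used P vis (P w) := by
  rintro (⟨i, hi, h⟩ | ⟨i, -, -, h, h'⟩)
  · rw [hP.injective h] at hw
    exact hw hi
  · rw [hP.lt_iff_lt] at h h'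
    lia

theorem Used.cons {P : ℕ → ℕ} {vis : List ℕ} {j : ℕ} (h : Used P vis j) (w : ℕ) :
    Used P (w :: vis) j := by
  rcases h with ⟨i, hi, h⟩ | ⟨i, hi, hi', h⟩
  · exact Or.inl ⟨i, by simp [hi], h⟩
  · exact Or.inr ⟨i, by simp [hi], by simp [hi'], h⟩

theorem reach_sound (hf : IsPathOn G f lo hi)
    {P : ℕ → ℕ} (hP : StrictMono P) (h0 : lo ≤ P 0) {ds : List ℕ}
    (hds : ∀ i d, ds[i]? = some d → P (i + 1) ≤ hi ∧ (P (i + 1) - P i) % 4 = d)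
    {E : List (ℕ × ℕ)}
    (hE : ∀ i j, (i, j) ∈ E → P i ≤ hi ∧ P j ≤ hi ∧ G.Adj (f (P i)) (f (P j)))
    {a t n cur : ℕ} {vis : List ℕ} {len : ℕ} (hcur : P cur ≤ hi) (hvis : cur ∈ vis)
    (h : reach (moves E ds 0 fun l => l) a t n cur vis len = true) :
    ∃ ℓ S, HasPathIn G (f '' S) (f (P cur)) (f (P a)) ℓ ∧ (len + ℓ) % 4 = t ∧
      S ⊆ Set.Icc lo hi ∧ ∀ j ∈ S, Used P vis j → j = P cur := by
  have hlo : ∀ i, lo ≤ P i := fun i => h0.trans (hP.monotone i.zero_le)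
  induction n generalizing cur vis len with
  | zero => cases h
  | succ n ih =>
    change Bool.rec (anyPair (fun w d => Bool.rec
      (reach (moves E ds 0 fun l => l) a t n w (w :: vis) (len + d)) false (memb w vis))
      (entry (moves E ds 0 fun l => l) cur)) (Nat.beq (len % 4) t) (Nat.beq cur a) = true at h
    cases hca : Nat.beq cur a <;> simp only [hca] at h
    swap
    · obtain rfl := Nat.eq_of_beq_eq_true hca
      refine ⟨0, {P cur}, .refl ⟨_, rfl, rfl⟩, by simpa using h, ?_, by simp⟩
      simpa using ⟨hlo _, hcur⟩
    obtain ⟨w, d, hmv, hw⟩ := anyPair_iff.1 h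
    cases hwv : memb w vis <;> simp only [hwv] at hw
    swap
    · cases hw
    have hwv : w ∉ vis := by rw [← memb_iff, hwv]; simp
    have key : P w ≤ hi ∧ ((w = cur + 1 ∧ d = (P w - P cur) % 4) ∨
        (cur = w + 1 ∧ d = (P cur - P w) % 4) ∨ (d = 1 ∧ G.Adj (f (P cur)) (f (P w)))) := by
      rcases mem_entry_moves hmv with ⟨-, l, hl, hl'⟩ | ⟨rfl, h2⟩ | ⟨m, rfl, rfl, h2⟩ | ⟨rfl, h'⟩
      · exact absurd hl hl'
      · obtain ⟨h3, rfl⟩ := hds _ _ h2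
        rw [zero_add]
        exact ⟨h3, Or.inl ⟨rfl, rfl⟩⟩
      · obtain ⟨h3, rfl⟩ := hds _ _ h2
        rw [zero_add]
        exact ⟨(hP.monotone (Nat.le_succ m)).trans h3, Or.inr (Or.inl ⟨rfl, rfl⟩)⟩
      · rw [zero_add] at h'
        rcases h' with h' | h'
        · exact ⟨(hE _ _ h').2.1, Or.inr (Or.inr ⟨rfl, (hE _ _ h').2.2⟩)⟩
        · exact ⟨(hE _ _ h').1, Or.inr (Or.inr ⟨rfl, (hE _ _ h').2.2.symm⟩)⟩
    obtain ⟨hwhi, key⟩ := key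
    obtain ⟨ℓ, S, hp, hl, hS, hdisj⟩ := ih hwhi (List.mem_cons_self) hw
    have hS' : ∀ j ∈ S, ¬ Used P vis j := fun j hj hu => by
      have := hdisj j hj (hu.cons w)
      subst this
      exact not_used hP hwv hu
    have arc : ∀ i k, i + 1 = k → P k ≤ hi → i ∈ w :: vis → k ∈ w :: vis →
        (i = w ∧ k = cur ∨ i = cur ∧ k = w) →
        HasPathIn G (f '' Set.Icc (P i) (P k)) (f (P cur)) (f (P w)) (P k - P i) →
        ∃ ℓ' S, HasPathIn G (f '' S) (f (P cur)) (f (P a)) ℓ' ∧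
          ℓ' = P k - P i + ℓ ∧ S ⊆ Set.Icc lo hi ∧ ∀ j ∈ S, Used P vis j → j = P cur := by
      rintro i k rfl hk hi' hk' hik hseg
      have hsub : Set.Icc (P i) (P (i + 1)) ⊆ Set.Icc lo hi :=
        Set.Icc_subset_Icc (hlo i) hk
      have hdj : ∀ j ∈ S, j ∈ Set.Icc (P i) (P (i + 1)) → j = P w := by
        rintro j hj ⟨h1, h2⟩
        refine hdisj j hj ?_
        by_cases h3 : j = P i
        · exact Or.inl ⟨i, hi', h3⟩
        by_cases h4 : j = P (i + 1)
        · exact Or.inl ⟨i + 1, hk', h4⟩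
        exact Or.inr ⟨i, hi', hk', by lia, by lia⟩
      refine ⟨_, Set.Icc (P i) (P (i + 1)) ∪ S, ?_, rfl, Set.union_subset hsub hS, ?_⟩
      · rw [Set.image_union]
        refine hseg.append hp ?_
        rintro x ⟨j, hj, rfl⟩ ⟨j', hj', he⟩
        obtain rfl := hf.injOn (hS hj') (hsub hj) he
        rw [hdj _ hj' hj]
      · rintro j (⟨h1, h2⟩ | hj) hu
        · rcases hu with ⟨m, hm, rfl⟩ | ⟨m, hm, hm', h3, h4⟩
          · rw [hP.le_iff_le] at h1 h2
            have : m ≠ w := fun h => hwv (h ▸ hm)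
            have : m = cur := by lia
            rw [this]
          · have h5 := hP.lt_iff_lt.1 (h3.trans_le h2)
            have h6 := hP.lt_iff_lt.1 (h1.trans_lt h4)
            have : m = i := by lia
            subst this
            rcases hik with ⟨rfl, -⟩ | ⟨-, rfl⟩
            · exact absurd hm hwv
            · exact absurd hm' hwv
        · exact absurd hu (hS' j hj)
    rcases key with ⟨rfl, rfl⟩ | ⟨rfl, rfl⟩ | ⟨rfl, hadj'⟩
    · obtain ⟨ℓ', S', h1, rfl, h3⟩ := arc cur (cur + 1) rfl hwhi (by simp [hvis]) (by simp)
        (Or.inr ⟨rfl, rfl⟩) (.segment (hf.mono (hlo _) hwhi) (hP.monotone (Nat.le_succ _)))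
      exact ⟨_, S', h1, by lia, h3⟩
    · obtain ⟨ℓ', S', h1, rfl, h3⟩ := arc w (w + 1) rfl hcur (by simp) (by simp [hvis])
        (Or.inl ⟨rfl, rfl⟩)
        (HasPathIn.symm (.segment (hf.mono (hlo _) hcur) (hP.monotone (Nat.le_succ _))))
      exact ⟨_, S', h1, by lia, h3⟩
    · refine ⟨ℓ + 1, insert (P cur) S, ?_, by lia, ?_, ?_⟩
      · rw [Set.image_insert_eq]
        refine hp.cons hadj' ?_
        rintro ⟨j, hj, he⟩
        obtain rfl := hf.injOn (hS hj) ⟨hlo _, hcur⟩ he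
        exact hS' _ hj (Or.inl ⟨cur, hvis, rfl⟩)
      · exact Set.insert_subset ⟨hlo _, hcur⟩ hS
      · rintro j (rfl | hj) hu
        · rfl
        · exact absurd hu (hS' j hj)

/-- The labels, placed at the positions `ρ`, are arranged in the classes `cs` with gaps `ds` from
position `p` on. -/
inductive Arranged (ρ : ℕ → ℕ) (hi : ℕ) : List (List ℕ) → List ℕ → ℕ → Prop
  | last {c : List ℕ} : (∀ x ∈ c, ρ x = hi) → Arranged ρ hi [c] [] hi
  | cons {c : List ℕ} {cs : List (List ℕ)} {ds : List ℕ} {d p q : ℕ} : (∀ x ∈ c, ρ x = p) →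
      p < q → (q - p) % 4 = d → Arranged ρ hi cs ds q → Arranged ρ hi (c :: cs) (d :: ds) p

variable {ρ : ℕ → ℕ} {cs : List (List ℕ)} {ds : List ℕ} {p x : ℕ}

theorem Arranged.ins (h : Arranged ρ hi cs ds p) (h1 : p ≤ ρ x) (h2 : ρ x ≤ hi) :
    ∃ r ∈ ins x cs ds, Arranged ρ hi r.1 r.2 p := by
  induction h with
  | last hc =>
    exact ⟨_, List.mem_singleton_self _, .last (by simpa using ⟨le_antisymm h2 h1, hc⟩)⟩
  | @cons c cs ds d p q hc hpq hd hr ih =>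
    rcases h1.eq_or_lt with h | h
    · exact ⟨_, List.mem_cons_self, .cons (by simpa using ⟨h.symm, hc⟩) hpq hd hr⟩
    rcases lt_or_ge (ρ x) q with h' | h'
    · refine ⟨_, List.mem_cons_of_mem _ (List.mem_append_left _ (List.mem_map_of_mem
        (a := (ρ x - p) % 4) ?_)), .cons hc h rfl (.cons (p := ρ x) (by simp) h' ?_ hr)⟩
      · have := Nat.mod_lt (ρ x - p) (show 0 < 4 by simp)
        simp only [List.mem_cons, List.not_mem_nil, or_false]
        lia
      · lia
    · obtain ⟨r, hr, hr'⟩ := ih h'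
      exact ⟨_, List.mem_cons_of_mem _ (List.mem_append_right _ (List.mem_map_of_mem hr)),
        .cons hc hpq hd hr'⟩

theorem Arranged.length_eq (h : Arranged ρ hi cs ds p) : cs.length = ds.length + 1 := by
  induction h <;> simp_all

theorem Arranged.exists_position (h : Arranged ρ hi cs ds p) : ∃ P : ℕ → ℕ, StrictMono P ∧ P 0 = p ∧
    (∀ i c, cs[i]? = some c → P i ≤ hi ∧ ∀ x ∈ c, ρ x = P i) ∧
    ∀ i d, ds[i]? = some d → P (i + 1) ≤ hi ∧ (P (i + 1) - P i) % 4 = d := by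
  induction h with
  | last hc =>
    refine ⟨fun i => hi + i, fun i j h => by simpa using h, rfl, fun i c h => ?_, by simp⟩
    obtain ⟨rfl, rfl⟩ : i = 0 ∧ _ = c := by simpa [List.getElem?_singleton] using h
    exact ⟨le_rfl, hc⟩
  | @cons c cs ds d p q hc hpq hd hr ih =>
    obtain ⟨P, hP, rfl, hcs, hds⟩ := ih
    have hq : P 0 ≤ hi := by
      cases hr with
      | last hc => exact le_rfl
      | cons hc => exact (hcs 0 _ rfl).1
    refine ⟨fun i => Nat.casesOn i p P, strictMono_nat_of_lt_succ fun n => ?_, rfl, ?_, ?_⟩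
    · cases n with
      | zero => exact hpq
      | succ n => exact hP n.lt_succ_self
    · rintro (_ | i) c' h
      · obtain rfl : c = c' := by simpa using h
        exact ⟨by change p ≤ hi; lia, hc⟩
      · exact hcs i c' (by simpa using h)
    · rintro (_ | i) d' h
      · obtain rfl : d = d' := by simpa using h
        exact ⟨hq, hd⟩
      · exact hds i d' (by simpa using h)

/-- The positions `ρ` on the path `f lo, …, f hi` in `G` meet the specification `p`. -/
structure Models (G : SimpleGraph V) (f : ℕ → V) (lo hi : ℕ) (ρ : ℕ → ℕ) (p : Problem) : Prop
    extends IsPathOn G f lo hi where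
  chords : ∀ a b, (a, b) ∈ p.chords →
    G.Adj (f (ρ a)) (f (ρ b)) ∧ (ρ a + 2 ≤ ρ b ∨ ρ b + 2 ≤ ρ a)
  virt : ∀ a b t, (a, b, t) ∈ p.virt →
    ∀ ℓ, HasPathIn G (f '' Set.Icc lo hi) (f (ρ a)) (f (ρ b)) ℓ → ℓ % 4 ≠ t
  succ : ∀ a b, (a, b) ∈ p.succ → ρ b = ρ a + 1
  neq : ∀ a b, (a, b) ∈ p.neq → ρ a ≠ ρ b
  lt : ∀ a b, (a, b) ∈ p.lt → ρ a < ρ b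

theorem Models.bad_eq_false {q : Problem} (hm : Models G f lo hi ρ q)
    (hG : ∀ n, HasCycleLen G n → n % 4 ≠ 2) (har : Arranged ρ hi cs ds lo) :
    bad q x cs ds = false := by
  obtain ⟨P, hP, h0, hcs, hds⟩ := har.exists_position
  have hlo : ∀ i, lo ≤ P i := fun i => h0 ▸ hP.monotone i.zero_le
  have res : ∀ {i j l}, (i, j) ∈ resolve cs l → ∃ a b, (a, b) ∈ l ∧
      (ρ a = P i ∧ P i ≤ hi) ∧ (ρ b = P j ∧ P j ≤ hi) := by
    intro i j l h
    obtain ⟨a, b, h, ⟨c, hc, ha⟩, ⟨c', hc', hb⟩⟩ := resolve_spec h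
    exact ⟨a, b, h, ⟨(hcs i c hc).2 a ha, (hcs i c hc).1⟩, (hcs j c' hc').2 b hb, (hcs j c' hc').1⟩
  have hE : ∀ i j, (i, j) ∈ resolve cs q.chords →
      P i ≤ hi ∧ P j ≤ hi ∧ G.Adj (f (P i)) (f (P j)) := by
    intro i j h
    obtain ⟨a, b, hab, ⟨ha, ha'⟩, hb, hb'⟩ := res h
    exact ⟨ha', hb', ha ▸ hb ▸ (hm.chords a b hab).1⟩
  rw [← Bool.not_eq_true]
  intro hbad
  simp only [bad, Bool.or_eq_true] at hbad
  rcases hbad with ((((hbad | hbad) | hbad) | hbad) | hbad) | hbad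
  · obtain ⟨i, j, hij, h⟩ := anyPair_iff.1 hbad
    obtain ⟨a, b, hab, ⟨ha, -⟩, hb, hb'⟩ := res hij
    have hs := hm.succ a b hab
    rw [ha, hb] at hs
    have hl := har.length_eq
    have hj : j = i + 1 := by
      refine le_antisymm ?_ (hP.lt_iff_lt.1 (by lia))
      by_contra! hj
      have h1 := hP (show i < i + 1 by lia)
      have h2 := hP hj
      lia
    subst hj
    have hlen : i < ds.length := by
      obtain ⟨a, b, h, -, ⟨c', hc', hb⟩⟩ := resolve_spec hij
      have := (List.getElem?_eq_some_iff.1 hc').1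
      lia
    have hg := (hds i ds[i] (by simp [hlen])).2
    have : gapOne ds i = true := by
      rw [gapOne_iff, List.getElem?_eq_getElem hlen, ← hg, hs]
      simp
    simp [this] at h
  · obtain ⟨i, j, hij, h⟩ := anyPair_iff.1 hbad
    obtain ⟨a, b, hab, ⟨ha, -⟩, hb, -⟩ := res hij
    obtain rfl := Nat.eq_of_beq_eq_true h
    exact hm.neq a b (mem_of_mem_relevant hab) (ha.trans hb.symm)
  · obtain ⟨i, j, hij, h⟩ := anyPair_iff.1 hbad
    obtain ⟨a, b, hab, ⟨ha, -⟩, hb, -⟩ := res hij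
    have := hP.monotone (Nat.le_of_ble_eq_true h)
    have := hm.lt a b (mem_of_mem_relevant hab)
    lia
  · obtain ⟨i, j, hij, h⟩ := anyPair_iff.1 hbad
    obtain ⟨a, b, hab, ⟨ha, -⟩, hb, -⟩ := res hij
    obtain rfl := Nat.eq_of_beq_eq_true h
    have := (hm.chords a b (mem_of_mem_relevant hab)).2
    lia
  · obtain ⟨i, j, hij, h⟩ := anyPair_iff.1 hbad
    obtain ⟨a, b, hab, ⟨ha, ha'⟩, hb, hb'⟩ := res hij
    obtain ⟨hadj, hgap⟩ := hm.chords a b (mem_of_mem_relevant hab)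
    rw [forceLists_eq] at h
    rw [ha, hb] at hadj hgap
    have hne : ∀ k, lo ≤ k → k ≤ hi → ∀ k', lo ≤ k' → k' ≤ hi →
        s(f k, f k') = s(f (P i), f (P j)) → (k = P i ∧ k' = P j) ∨ (k = P j ∧ k' = P i) := by
      intro k h1 h2 k' h1' h2' he
      rcases Sym2.eq_iff.1 he with ⟨h3, h4⟩ | ⟨h3, h4⟩
      · exact Or.inl ⟨hm.injOn ⟨h1, h2⟩ ⟨hlo _, ha'⟩ h3, hm.injOn ⟨h1', h2'⟩ ⟨hlo _, hb'⟩ h4⟩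
      · exact Or.inr ⟨hm.injOn ⟨h1, h2⟩ ⟨hlo _, hb'⟩ h3, hm.injOn ⟨h1', h2'⟩ ⟨hlo _, ha'⟩ h4⟩
    obtain ⟨ℓ, S, hp, hl, -, -⟩ := reach_sound (G := G.deleteEdges {s(f (P i), f (P j))})
      ⟨hm.injOn, fun k h1 h2 => by
        rw [deleteEdges_adj]
        refine ⟨hm.adj k h1 h2, fun he => ?_⟩
        have := hne k h1 h2.le (k + 1) (by lia) h2 he
        lia⟩ hP h0.ge hds (fun u v huv => by
        obtain ⟨huv, h1, h2⟩ := mem_without huv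
        obtain ⟨h3, h4, h5⟩ := hE u v huv
        refine ⟨h3, h4, ?_⟩
        rw [deleteEdges_adj]
        refine ⟨h5, fun he => ?_⟩
        rcases hne _ (hlo _) h3 _ (hlo _) h4 he with ⟨h6, h7⟩ | ⟨h6, h7⟩
        · exact h1 ⟨hP.injective h6, hP.injective h7⟩
        · exact h2 ⟨hP.injective h6, hP.injective h7⟩) hb' (List.mem_singleton_self j) h
    refine hG (ℓ + 1) ((hp.mono (deleteEdges_le _) subset_rfl).hasCycleLen hadj.symm ?_) (by lia)
    rintro rfl
    obtain ⟨w, -, hw, -⟩ := hp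
    have := Walk.adj_of_length_eq_one hw
    rw [deleteEdges_adj] at this
    exact this.2 (Sym2.eq_swap)
  · obtain ⟨⟨a, b, t⟩, hv, h⟩ := List.any_eq_true.1 hbad
    obtain ⟨i, j, hij, h⟩ := anyPair_iff.1 h
    obtain ⟨a', b', hab, ⟨ha, ha'⟩, hb, hb'⟩ := res hij
    obtain ⟨rfl, rfl⟩ : a' = a ∧ b' = b := by simpa using hab
    rw [forceLists_eq] at h
    obtain ⟨ℓ, S, hp, hl, hS, -⟩ := reach_sound hm.toIsPathOn hP h0.ge hds hE hb'
      (List.mem_singleton_self j) h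
    refine hm.virt _ _ _ hv ℓ ?_ (by simpa using hl)
    rw [ha, hb]
    exact hp.symm.subset (Set.image_mono hS)

theorem Models.search_eq_false {q : Problem} (hm : Models G f lo hi ρ q)
    (hG : ∀ n, HasCycleLen G n → n % 4 ≠ 2) {xs : List ℕ}
    (hx : ∀ x ∈ xs, lo ≤ ρ x ∧ ρ x ≤ hi) (h : Arranged ρ hi cs ds lo) :
    search q xs cs ds = false := by
  induction xs generalizing cs ds with
  | nil => rfl
  | cons x xs ih =>
    obtain ⟨r, hr, hr'⟩ := h.ins (hx x (by simp)).1 (hx x (by simp)).2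
    rw [search, List.all_eq_false]
    exact ⟨r, hr, by
      rw [hm.bad_eq_false hG hr', ih (fun y hy => hx y (List.mem_cons_of_mem _ hy)) hr']; simp⟩

/-- A specification which is refuted by the search has no models. -/
theorem Models.false_of_refute {q : Problem} (hm : Models G f lo hi ρ q)
    (hG : ∀ n, HasCycleLen G n → n % 4 ≠ 2) {xs : List ℕ} (hq : refute q xs = true)
    (hlohi : lo < hi) (h0 : ρ 0 = lo) (h1 : ρ 1 = hi) (hx : ∀ x ∈ xs, lo ≤ ρ x ∧ ρ x ≤ hi) :
    False := by
  have har : Arranged ρ hi [[0], [1]] [(hi - lo) % 4] lo :=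
    .cons (by simpa using h0) hlohi rfl (.last (by simpa using h1))
  have := List.all_eq_true.1 hq ((hi - lo) % 4) (by
    have := Nat.mod_lt (hi - lo) (show 0 < 4 by simp)
    simp only [List.mem_cons, List.not_mem_nil, or_false]
    lia)
  rw [hm.bad_eq_false hG har, hm.search_eq_false hG hx har] at this
  simp at this

end Soundness

/-- The configuration of `rotation_residues`. -/
def rotationProblem (t u : ℕ) : Problem where
  chords := [(0, 1), (0, 3), (2, 4)]
  virt := [(1, 5, t), (1, 5, u)]
  succ := [(2, 1)]
  lt := [(0, 5), (5, 2), (3, 2), (0, 4)]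

/-- The configuration of `rotation_residues` when the last but one vertex is joined to the first. -/
def shortRotationProblem (t u : ℕ) : Problem where
  chords := [(0, 1), (0, 2), (3, 4)]
  virt := [(1, 5, t), (1, 5, u)]
  succ := [(2, 1), (0, 3)]
  lt := [(3, 5), (5, 2)]

/-- A path whose last vertex is joined to its first vertex and to another one. -/
def thetaProblem (t : ℕ) : Problem where
  chords := [(0, 1), (1, 2)]
  virt := [(3, 4, (t + 1) % 4), (3, 4, (t + 2) % 4), (3, 4, (t + 3) % 4)]
  lt := [(3, 4), (0, 2)]

/-- A long cycle, all of whose vertices except for three pairwise nonadjacent ones can be ends. -/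
def threeRootsProblem : Problem where
  chords := [(1, 2), (0, 3), (0, 4), (1, 5), (6, 8), (7, 9), (10, 11), (12, 13)]
  succ := [(2, 6), (5, 7), (10, 3), (4, 12)]
  neq := [(6, 3), (6, 4), (7, 3), (7, 4), (10, 2), (5, 2)]
  lt := [(0, 2), (2, 3), (3, 4), (4, 1), (5, 1), (0, 5), (0, 6), (0, 8), (0, 7), (0, 9), (0, 10),
    (0, 11), (0, 12), (0, 13), (2, 6), (2, 7), (2, 10), (2, 12), (2, 5)]

/-- A Hamiltonian cycle with a shortest chord of length at least `4`. -/
def longChordProblem : Problem where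
  chords := [(0, 1), (0, 2), (3, 5), (7, 8), (4, 6)]
  succ := [(0, 3), (3, 4), (7, 2)]
  lt := [(2, 1), (4, 7), (2, 5), (2, 6), (2, 8)]

/-- A Hamiltonian cycle with a shortest chord of length `3`. -/
def threeChordProblem : Problem where
  chords := [(0, 1), (0, 4), (2, 5), (3, 7), (6, 8), (9, 10)]
  succ := [(0, 2), (2, 3), (3, 4), (4, 6), (6, 9)]
  lt := [(4, 5), (4, 7), (6, 1)]

/-- A Hamiltonian cycle with a shortest chord of length `2`. -/
def twoChordProblem : Problem where
  chords := [(0, 1), (0, 3), (2, 4), (7, 8), (5, 6), (1, 13), (9, 10), (11, 12)]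
  succ := [(0, 2), (2, 3), (3, 7), (7, 9), (5, 1), (9, 11)]
  neq := [(13, 0), (13, 5)]
  lt := [(3, 4), (9, 1)]

theorem refute_rotationProblem {t u : ℕ} (ht : t < 4) (hu : u < 4) (h : t ≠ u) :
    refute (rotationProblem t u) [2, 3, 4, 5] = true := by
  have : ∀ t < 4, ∀ u < 4, t ≠ u → refute (rotationProblem t u) [2, 3, 4, 5] = true := by
    decide +kernel
  exact this t ht u hu h

theorem refute_shortRotationProblem {t u : ℕ} (ht : t < 4) (hu : u < 4) (h : t ≠ u) :
    refute (shortRotationProblem t u) [2, 3, 4, 5] = true := by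
  have : ∀ t < 4, ∀ u < 4, t ≠ u → refute (shortRotationProblem t u) [2, 3, 4, 5] = true := by
    decide +kernel
  exact this t ht u hu h

theorem refute_thetaProblem {t : ℕ} (ht : t < 4) :
    refute (thetaProblem t) [2, 3, 4] = true := by
  have : ∀ t < 4, refute (thetaProblem t) [2, 3, 4] = true := by
    decide +kernel
  exact this t ht

theorem refute_threeRootsProblem :
    refute threeRootsProblem [2, 3, 4, 5, 6, 7, 8, 9, 10, 11, 12, 13] = true := by
  decide +kernel

theorem refute_longChordProblem :
    refute longChordProblem [2, 3, 4, 5, 6, 7, 8] = true := by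
  decide +kernel

theorem refute_threeChordProblem :
    refute threeChordProblem [2, 3, 4, 5, 6, 7, 8, 9, 10] = true := by
  decide +kernel

theorem refute_twoChordProblem :
    refute twoChordProblem [2, 3, 4, 5, 6, 7, 8, 9, 10, 11, 12, 13] = true := by
  decide +kernel

end PathSearch

section LongestPaths

variable {V : Type*} {G : SimpleGraph V} {f g : ℕ → V} {m N : ℕ}

/-- `f 0, …, f N` is a longest path, and no longest path has a first vertex with a neighbour
beyond position `m`. -/
structure Extremal (G : SimpleGraph V) (f : ℕ → V) (m N : ℕ) : Prop where
  path : IsPathOn G f 0 N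
  longest : ∀ g n, IsPathOn G g 0 n → n ≤ N
  le : m ≤ N
  adj : G.Adj (f 0) (f m)
  furthest : ∀ g k, IsPathOn G g 0 N → k ≤ N → G.Adj (g 0) (g k) → k ≤ m

theorem IsPathOn.comp {n : ℕ} {σ : ℕ → ℕ} (hf : IsPathOn G f 0 N) (hσ : ∀ j ≤ n, σ j ≤ N)
    (hinj : ∀ i ≤ n, ∀ j ≤ n, σ i = σ j → i = j)
    (hadj : ∀ j < n, G.Adj (f (σ j)) (f (σ (j + 1)))) : IsPathOn G (f ∘ σ) 0 n := by
  refine ⟨fun i hi j hj h => ?_, fun j _ hj => hadj j hj⟩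
  exact hinj i hi.2 j hj.2 (hf.injOn ⟨Nat.zero_le _, hσ i hi.2⟩ ⟨Nat.zero_le _, hσ j hj.2⟩ h)

theorem IsPathOn.cons (hf : IsPathOn G f 0 N) {x : V} (hx : G.Adj (f 0) x)
    (hx' : x ∉ f '' Set.Icc 0 N) : ∃ g, IsPathOn G g 0 (N + 1) := by
  refine ⟨fun j => if j = 0 then x else f (j - 1), ?_, ?_⟩
  · rintro i ⟨-, hi⟩ j ⟨-, hj⟩ h
    by_cases hi0 : i = 0 <;> by_cases hj0 : j = 0 <;> simp only [hi0, hj0, if_true, if_false] at h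
    · lia
    · exact absurd ⟨j - 1, ⟨Nat.zero_le _, by lia⟩, h.symm⟩ hx'
    · exact absurd ⟨i - 1, ⟨Nat.zero_le _, by lia⟩, h⟩ hx'
    · have := hf.injOn ⟨Nat.zero_le _, by lia⟩ ⟨Nat.zero_le _, by lia⟩ h
      lia
  · rintro (_ | j) - hj
    · simpa using hx.symm
    · simpa using hf.adj j (Nat.zero_le _) (by lia)

/-- The path obtained by reversing its initial segment before position `p`. -/
def rotate (f : ℕ → V) (p : ℕ) : ℕ → V :=
  f ∘ fun j => if j < p then p - 1 - j else j

theorem IsPathOn.rotate {p : ℕ} (hf : IsPathOn G f 0 N) (h1 : 1 ≤ p) (hp : p ≤ N)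
    (h : G.Adj (f 0) (f p)) : IsPathOn G (rotate f p) 0 N := by
  refine hf.comp (fun j hj => by split_ifs <;> lia) (fun i hi j hj h => ?_) fun j hj => ?_
  · split_ifs at h <;> lia
  · rcases lt_trichotomy (j + 1) p with h' | h' | h'
    · simp only [show j < p by lia, h', if_true]
      have := hf.adj (p - 1 - (j + 1)) (Nat.zero_le _) (by lia)
      rw [show p - 1 - (j + 1) + 1 = p - 1 - j by lia] at this
      exact this.symm
    · subst h'
      simpa using h
    · simp only [show ¬ j < p by lia, show ¬ j + 1 < p by lia, if_false]
      exact hf.adj j (Nat.zero_le _) hj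

theorem rotate_mem {p : ℕ} (hp : p ≤ m + 1) {j : ℕ} (hj : j ≤ m) :
    rotate f p j ∈ f '' Set.Icc 0 m :=
  ⟨_, ⟨Nat.zero_le _, by beta_reduce; split_ifs <;> lia⟩, rfl⟩

namespace Extremal

theorem injOn_iff (h : Extremal G f m N) {i j : ℕ} (hi : i ≤ N) (hj : j ≤ N) :
    f i = f j ↔ i = j :=
  ⟨fun he => h.path.injOn ⟨Nat.zero_le _, hi⟩ ⟨Nat.zero_le _, hj⟩ he, fun he => he ▸ rfl⟩

theorem exists_of_adj (h : Extremal G f m N) (hg : IsPathOn G g 0 N) {x : V}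
    (hx : G.Adj (g 0) x) : ∃ k ≤ m, 0 < k ∧ x = g k := by
  by_cases hx' : x ∈ g '' Set.Icc 0 N
  · obtain ⟨k, ⟨-, hk⟩, rfl⟩ := hx'
    refine ⟨k, h.furthest g k hg hk hx, Nat.pos_of_ne_zero ?_, rfl⟩
    rintro rfl
    exact hx.ne rfl
  · obtain ⟨g', hg'⟩ := hg.cons hx hx'
    have := h.longest g' _ hg'
    lia

theorem exists_of_adj' (h : Extremal G f m N) (hg : IsPathOn G g 0 N)
    (hg' : ∀ j ≤ m, g j ∈ f '' Set.Icc 0 m) {x : V} (hx : G.Adj (g 0) x) :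
    x ∈ f '' Set.Icc 0 m := by
  obtain ⟨k, hk, -, rfl⟩ := h.exists_of_adj hg hx
  exact hg' k hk

end Extremal

variable [Fintype V]

theorem exists_adj_ne_ne [DecidableEq V] [DecidableRel G.Adj] (hδ : ∀ v, 3 ≤ G.degree v)
    (v a b : V) : ∃ x, G.Adj v x ∧ x ≠ a ∧ x ≠ b := by
  have : ∃ x ∈ G.neighborFinset v, x ∉ ({a, b} : Finset V) := by
    apply Finset.exists_mem_notMem_of_card_lt_card
    have := hδ v
    have := Finset.card_le_two (a := a) (b := b)
    rw [G.card_neighborFinset_eq_degree]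
    lia
  obtain ⟨x, hx, hx'⟩ := this
  exact ⟨x, by simpa using hx, by simpa using hx'⟩

theorem exists_max {P : ℕ → Prop} {b : ℕ} (hP : ∃ n, P n) (hb : ∀ n, P n → n ≤ b) :
    ∃ n, P n ∧ ∀ k, P k → k ≤ n := by
  classical
  obtain ⟨n, hn⟩ := hP
  exact ⟨Nat.findGreatest P b, Nat.findGreatest_spec (hb n hn) hn,
    fun k hk => Nat.le_findGreatest (hb k hk) hk⟩

theorem exists_extremal [Nonempty V] (h : ∀ v : V, ∃ w, G.Adj v w) : ∃ f m N, Extremal G f m N := by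
  obtain ⟨N, ⟨f, hf⟩, hN⟩ := exists_max (P := fun n => ∃ f, IsPathOn G f 0 n) (b := Fintype.card V)
    ⟨0, fun _ => Classical.arbitrary V, by simp, by simp⟩ (by
      rintro n ⟨f, hf⟩
      have := Fintype.card_le_of_injective (fun i : Fin (n + 1) => f i) fun i j hij =>
        Fin.ext (hf.injOn ⟨Nat.zero_le _, by lia⟩ ⟨Nat.zero_le _, by lia⟩ hij)
      simp at this
      lia)
  obtain ⟨m, ⟨g, hg, hm, hgm⟩, hmax⟩ := exists_max
    (P := fun m => ∃ f, IsPathOn G f 0 N ∧ m ≤ N ∧ G.Adj (f 0) (f m)) (b := N) (by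
      obtain ⟨x, hx⟩ := h (f 0)
      by_cases hx' : x ∈ f '' Set.Icc 0 N
      · obtain ⟨k, ⟨-, hk⟩, rfl⟩ := hx'
        exact ⟨k, f, hf, hk, hx⟩
      · obtain ⟨g', hg'⟩ := hf.cons hx hx'
        have := hN _ ⟨g', hg'⟩
        lia) (by rintro n ⟨f, hf, h, -⟩; exact h)
  exact ⟨g, m, N, hg, fun g n hg => hN n ⟨g, hg⟩, hm, hgm, fun g k hg hk h => hmax k ⟨g, hg, hk, h⟩⟩

end LongestPaths

section Rotations

variable {V : Type*} {G : SimpleGraph V} {f g : ℕ → V} {m N k l : ℕ} {S T : Set V} {a b : V}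

/-- Two internally disjoint paths form a cycle. -/
theorem HasPathIn.hasCycleLen_add (h : HasPathIn G S a b k) (h' : HasPathIn G T a b l)
    (hST : ∀ x ∈ S, x ∈ T → x = a ∨ x = b) (hab : a ≠ b) (hl : 2 ≤ l) :
    HasCycleLen G (k + l) := by
  obtain ⟨q, hq, rfl, hq'⟩ := h'
  cases q with
  | nil => exact absurd rfl hab
  | @cons _ c _ hac q =>
    rw [Walk.cons_isPath_iff] at hq
    rw [Walk.length_cons] at hl ⊢
    have hk : k ≠ 0 := by
      rintro rfl
      obtain ⟨p, -, hp, -⟩ := h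
      exact hab (Walk.eq_of_length_eq_zero hp)
    have hqT : HasPathIn G (T \ {a}) c b q.length := ⟨q, hq.1, rfl, fun x hx =>
      ⟨hq' x (by simp [hx]), fun hxa => hq.2 (by rwa [← Set.mem_singleton_iff.1 hxa])⟩⟩
    exact (h.append hqT.symm fun x hx hx' => (hST x hx hx'.1).resolve_left hx'.2).hasCycleLen hac
      (by lia)

namespace PathSearch

theorem Models.of_list {lo hi : ℕ} {q : Problem} (l : List ℕ) (hf : IsPathOn G f lo hi)
    (chords : ∀ x ∈ q.chords, G.Adj (f (l.getD x.1 0)) (f (l.getD x.2 0)) ∧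
      (l.getD x.1 0 + 2 ≤ l.getD x.2 0 ∨ l.getD x.2 0 + 2 ≤ l.getD x.1 0))
    (virt : ∀ x ∈ q.virt, ∀ ℓ, HasPathIn G (f '' Set.Icc lo hi) (f (l.getD x.1 0))
      (f (l.getD x.2.1 0)) ℓ → ℓ % 4 ≠ x.2.2)
    (succ : ∀ x ∈ q.succ, l.getD x.2 0 = l.getD x.1 0 + 1)
    (neq : ∀ x ∈ q.neq, l.getD x.1 0 ≠ l.getD x.2 0)
    (lt : ∀ x ∈ q.lt, l.getD x.1 0 < l.getD x.2 0) : Models G f lo hi (fun i => l.getD i 0) q :=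
  { toIsPathOn := hf
    chords := fun a b h => chords (a, b) h
    virt := fun a b t h => virt (a, b, t) h
    succ := fun a b h => succ (a, b) h
    neq := fun a b h => neq (a, b) h
    lt := fun a b h => lt (a, b) h }

end PathSearch

open PathSearch

namespace Extremal

variable [Fintype V] [DecidableEq V] [DecidableRel G.Adj]

theorem three_le (h : Extremal G f m N) (hδ : ∀ v, 3 ≤ G.degree v) : 3 ≤ m := by
  obtain ⟨x, hx, h1, h2⟩ := exists_adj_ne_ne hδ (f 0) (f 1) (f 2)
  obtain ⟨k, hk, h0, rfl⟩ := h.exists_of_adj h.path hx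
  by_contra! hm
  interval_cases m <;> interval_cases k <;> simp_all

/-- Paths around the extremal cycle between its root and a vertex with a neighbour outside of the
cycle have lengths of at least three residues mod 4. -/
theorem rotation_residues (h : Extremal G f m N) (hδ : ∀ v, 3 ≤ G.degree v)
    (hG : ∀ n, HasCycleLen G n → n % 4 ≠ 2) (hk : k < m) {y : V} (hy : G.Adj (f k) y)
    (hy' : y ∉ f '' Set.Icc 0 m) {t u : ℕ} (ht : t < 4) (hu : u < 4) (htu : t ≠ u)
    (Ht : ∀ ℓ, HasPathIn G (f '' Set.Icc 0 m) (f m) (f k) ℓ → ℓ % 4 ≠ t)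
    (Hu : ∀ ℓ, HasPathIn G (f '' Set.Icc 0 m) (f m) (f k) ℓ → ℓ % 4 ≠ u) : False := by
  have hm := h.three_le hδ
  have hmN := h.le
  have notEnd : ∀ g, IsPathOn G g 0 N → (∀ j ≤ m, g j ∈ f '' Set.Icc 0 m) → g 0 ≠ f k :=
    fun g hg hg' h0 => hy' (h.exists_of_adj' hg hg' (h0 ▸ hy))
  have hk0 : k ≠ 0 := by
    rintro rfl
    exact notEnd f h.path (fun j hj => ⟨j, ⟨Nat.zero_le _, hj⟩, rfl⟩) rfl
  have hr := h.path.rotate (by lia) h.le h.adj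
  have hr' : ∀ j ≤ m, rotate f m j ∈ f '' Set.Icc 0 m := fun j => rotate_mem (by lia)
  have hr0 : rotate f m 0 = f (m - 1) := by simp [rotate, show 0 < m by lia]
  have hk1 : k ≠ m - 1 := by
    rintro rfl
    exact notEnd _ hr hr' hr0
  by_cases hshort : G.Adj (f 0) (f (m - 1))
  · have hm1 : rotate f m (m - 1) = f 0 := by simp [rotate, show 0 < m by lia]
    have hs := hr.rotate (p := m - 1) (by lia) (by lia) (by rw [hr0, hm1]; exact hshort.symm)
    have hs0 : rotate (rotate f m) (m - 1) 0 = f 1 := by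
      simp only [rotate, Function.comp, show 0 < m - 1 by lia, if_true,
        show m - 1 - 1 - 0 < m by lia]
      congr 1
      lia
    have hs' : ∀ j ≤ m, rotate (rotate f m) (m - 1) j ∈ f '' Set.Icc 0 m := by
      intro j hj
      obtain ⟨i, hi, hi'⟩ := rotate_mem (f := rotate f m) (p := m - 1) (by lia) hj
      rw [← hi']
      exact hr' i hi.2
    have hk2 : k ≠ 1 := by
      rintro rfl
      exact notEnd _ hs hs' hs0
    obtain ⟨x, hx, h1, h2⟩ := exists_adj_ne_ne hδ (f 1) (f 0) (f 2)
    obtain ⟨j, ⟨-, hj⟩, rfl⟩ := h.exists_of_adj' hs hs' (hs0 ▸ hx)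
    have hj0 : j ≠ 0 := fun e => h1 (e ▸ rfl)
    have hj2 : j ≠ 2 := fun e => h2 (e ▸ rfl)
    have hj1 : j ≠ 1 := by
      rintro rfl
      exact hx.ne rfl
    refine (Models.of_list (q := shortRotationProblem t u) [0, m, m - 1, 1, j, k]
      (h.path.mono le_rfl h.le) ?_ ?_ ?_ ?_ ?_).false_of_refute hG
      (refute_shortRotationProblem ht hu htu) (by lia) rfl rfl ?_
    all_goals simp [shortRotationProblem]
    · exact ⟨⟨h.adj, by lia⟩, ⟨hshort, by lia⟩, hx, by lia⟩
    · exact ⟨Ht, Hu⟩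
    all_goals lia
  · obtain ⟨x, hx, h1, h2⟩ := exists_adj_ne_ne hδ (f 0) (f 1) (f m)
    obtain ⟨p, hp, hp0, rfl⟩ := h.exists_of_adj h.path hx
    have hp1 : p ≠ 1 := fun e => h1 (e ▸ rfl)
    have hpm : p ≠ m := fun e => h2 (e ▸ rfl)
    have hpm1 : p ≠ m - 1 := fun e => hshort (e ▸ hx)
    obtain ⟨x, hy, h1, h2⟩ := exists_adj_ne_ne hδ (f (m - 1)) (f (m - 2)) (f m)
    obtain ⟨q, ⟨-, hq⟩, rfl⟩ := h.exists_of_adj' hr hr' (hr0 ▸ hy)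
    have hq1 : q ≠ m - 2 := fun e => h1 (e ▸ rfl)
    have hqm : q ≠ m := fun e => h2 (e ▸ rfl)
    have hqm1 : q ≠ m - 1 := by
      rintro rfl
      exact hy.ne rfl
    have hq0 : q ≠ 0 := fun e => hshort (e ▸ hy.symm)
    refine (Models.of_list (q := rotationProblem t u) [0, m, m - 1, p, q, k]
      (h.path.mono le_rfl h.le) ?_ ?_ ?_ ?_ ?_).false_of_refute hG
      (refute_rotationProblem ht hu htu) (by lia) rfl rfl ?_
    all_goals simp [rotationProblem]
    · exact ⟨⟨h.adj, by lia⟩, ⟨hx, by lia⟩, hy, by lia⟩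
    · exact ⟨Ht, Hu⟩
    all_goals lia

/-- Paths outside of the extremal cycle between its root and another vertex of the cycle have
lengths of the same residue mod 4. -/
theorem mod_eq (h : Extremal G f m N) (hδ : ∀ v, 3 ≤ G.degree v)
    (hG : ∀ n, HasCycleLen G n → n % 4 ≠ 2) (hk : k < m) {y : V} (hy : G.Adj (f k) y)
    (hy' : y ∉ f '' Set.Icc 0 m) {S T : Set V} {a b : ℕ}
    (ha : HasPathIn G S (f m) (f k) a) (hb : HasPathIn G T (f m) (f k) b) (ha2 : 2 ≤ a)
    (hb2 : 2 ≤ b) (hS : ∀ x ∈ S, x ∈ f '' Set.Icc 0 m → x = f m ∨ x = f k)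
    (hT : ∀ x ∈ T, x ∈ f '' Set.Icc 0 m → x = f m ∨ x = f k) : a % 4 = b % 4 := by
  by_contra hab
  have hne : f m ≠ f k := by
    rw [Ne, h.injOn_iff h.le (hk.le.trans h.le)]
    lia
  refine h.rotation_residues hδ hG hk hy hy' (t := (4 + 2 - a % 4) % 4) (u := (4 + 2 - b % 4) % 4)
    (by lia) (by lia) (by lia) ?_ ?_
  · intro ℓ hℓ he
    have := hG _ (hℓ.hasCycleLen_add ha (fun x h1 h2 => hS x h2 h1) hne ha2)
    lia
  · intro ℓ hℓ he
    have := hG _ (hℓ.hasCycleLen_add hb (fun x h1 h2 => hT x h2 h1) hne hb2)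
    lia

end Extremal

end Rotations

section Cores

variable {V : Type*} {G : SimpleGraph V} {f g : ℕ → V} {M S T A B : Set V} {a b x y z : V}
  {m N k l n : ℕ}

/-- There are paths between `x` and `y` inside `S` whose lengths differ mod 4. -/
def TwoResidues (G : SimpleGraph V) (S : Set V) (x y : V) : Prop :=
  ∃ k l, HasPathIn G S x y k ∧ HasPathIn G S x y l ∧ k % 4 ≠ l % 4

theorem TwoResidues.symm (h : TwoResidues G S x y) : TwoResidues G S y x := by
  obtain ⟨k, l, hk, hl, hkl⟩ := h
  exact ⟨k, l, hk.symm, hl.symm, hkl⟩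

theorem TwoResidues.subset (h : TwoResidues G S x y) (hST : S ⊆ T) : TwoResidues G T x y := by
  obtain ⟨k, l, hk, hl, hkl⟩ := h
  exact ⟨k, l, hk.subset hST, hl.subset hST, hkl⟩

theorem TwoResidues.append (h : TwoResidues G S x y) (h' : HasPathIn G T y z n)
    (hST : ∀ w ∈ S, w ∈ T → w = y) : TwoResidues G (S ∪ T) x z := by
  obtain ⟨k, l, hk, hl, hkl⟩ := h
  exact ⟨k + n, l + n, hk.append h' hST, hl.append h' hST, by lia⟩

/-- Any two vertices of `M` are joined by paths inside `M` whose lengths differ mod 4. -/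
def IsCore (G : SimpleGraph V) (M : Set V) : Prop :=
  ∀ x ∈ M, ∀ y ∈ M, x ≠ y → TwoResidues G M x y

theorem HasPathIn.segment' {lo hi i j : ℕ} (hf : IsPathOn G f lo hi) (h1 : lo ≤ i) (h2 : i ≤ j)
    (h3 : j ≤ hi) : HasPathIn G (f '' Set.Icc i j) (f i) (f j) (j - i) :=
  .segment (hf.mono h1 h3) h2

/-- Adding an ear to a core yields a core. -/
theorem IsCore.union_ear (hM : IsCore G M) (hg : IsPathOn G g 0 n) (hn : 0 < n) (h0 : g 0 ∈ M)
    (hgn : g n ∈ M) (hgM : ∀ i, 0 < i → i < n → g i ∉ M) : IsCore G (M ∪ g '' Set.Icc 0 n) := by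
  have hinj : ∀ {i j}, i ≤ n → j ≤ n → g i = g j → i = j := fun hi hj h =>
    hg.injOn ⟨Nat.zero_le _, hi⟩ ⟨Nat.zero_le _, hj⟩ h
  have hsub : ∀ {i j}, j ≤ n → M ∪ g '' Set.Icc i j ⊆ M ∪ g '' Set.Icc 0 n := fun hj =>
    Set.union_subset_union_right _ (Set.image_mono (Set.Icc_subset_Icc (Nat.zero_le _) hj))
  have h0n : g 0 ≠ g n := fun h => hn.ne (hinj (Nat.zero_le _) le_rfl h)
  have mixed : ∀ x ∈ M, ∀ i, 0 < i → i < n → TwoResidues G (M ∪ g '' Set.Icc 0 n) x (g i) := by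
    intro x hx i hi hin
    by_cases hx0 : x = g 0
    · have hxn : x ≠ g n := hx0 ▸ h0n
      refine ((hM x hx _ hgn hxn).append
        (HasPathIn.segment' hg (Nat.zero_le i) hin.le le_rfl).symm ?_).subset (hsub le_rfl)
      rintro _ hw ⟨j, ⟨hj, hj'⟩, rfl⟩
      rcases hj'.lt_or_eq with hj' | rfl
      · exact absurd hw (hgM j (by lia) hj')
      · rfl
    · refine ((hM x hx _ h0 hx0).append
        (HasPathIn.segment' hg le_rfl hi.le hin.le) ?_).subset (hsub hin.le)
      rintro _ hw ⟨j, ⟨hj, hj'⟩, rfl⟩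
      rcases hj.lt_or_eq with hj | rfl
      · exact absurd hw (hgM j hj (by lia))
      · rfl
  have inner : ∀ i j, 0 < i → i < j → j < n →
      TwoResidues G (M ∪ g '' Set.Icc 0 n) (g i) (g j) := by
    intro i j hi hij hj
    have h1 := (hM _ hgn _ h0 h0n.symm).append
      (HasPathIn.segment' hg le_rfl hi.le (hij.le.trans hj.le)) (by
        rintro _ hw ⟨k, ⟨hk, hk'⟩, rfl⟩
        rcases hk.lt_or_eq with hk | rfl
        · exact absurd hw (hgM k hk (by lia))
        · rfl)
    refine (h1.symm.append (HasPathIn.segment' hg (Nat.zero_le j) hj.le le_rfl).symm ?_).subset ?_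
    · rintro _ (hw | ⟨k', ⟨-, hk'⟩, he⟩) ⟨k, ⟨hk, hkn⟩, rfl⟩
      · rcases hkn.lt_or_eq with hkn | rfl
        · exact absurd hw (hgM k (by lia) hkn)
        · rfl
      · have := hinj (by lia) hkn he
        lia
    · refine Set.union_subset (hsub (by lia)) (Set.subset_union_of_subset_right ?_ _)
      exact Set.image_mono (Set.Icc_subset_Icc (Nat.zero_le _) le_rfl)
  have split : ∀ x ∈ M ∪ g '' Set.Icc 0 n, x ∈ M ∨ ∃ i, 0 < i ∧ i < n ∧ x = g i := by
    rintro _ (hx | ⟨i, ⟨-, hi⟩, rfl⟩)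
    · exact Or.inl hx
    · by_cases h1 : i = 0
      · exact Or.inl (h1 ▸ h0)
      by_cases h2 : i = n
      · exact Or.inl (h2 ▸ hgn)
      exact Or.inr ⟨i, by lia, by lia, rfl⟩
  intro x hx y hy hxy
  rcases split x hx with hx | ⟨i, hi, hin, rfl⟩ <;> rcases split y hy with hy | ⟨j, hj, hjn, rfl⟩
  · exact (hM x hx y hy hxy).subset Set.subset_union_left
  · exact mixed x hx j hj hjn
  · exact (mixed y hy i hi hin).symm
  · rcases lt_trichotomy i j with h | rfl | h
    · exact inner i j hi h hjn
    · exact absurd rfl hxy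
    · exact (inner j i hj h hin).symm

open PathSearch in
/-- A path whose last vertex is joined to its first vertex and to another one is a core. -/
theorem isCore_of_theta (hG : ∀ n, HasCycleLen G n → n % 4 ≠ 2) (hf : IsPathOn G f m n)
    (hmk : m < k) (hkn : k + 1 < n) (hm : G.Adj (f n) (f m)) (hk : G.Adj (f n) (f k)) :
    IsCore G (f '' Set.Icc m n) := by
  suffices h : ∀ i j, m ≤ i → i < j → j ≤ n → TwoResidues G (f '' Set.Icc m n) (f i) (f j) by
    rintro _ ⟨i, hi, rfl⟩ _ ⟨j, hj, rfl⟩ hij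
    rcases lt_trichotomy i j with h' | rfl | h'
    · exact h i j hi.1 h' hj.2
    · exact absurd rfl hij
    · exact (h j i hj.1 h' hi.2).symm
  intro i j hi hij hj
  by_contra hcon
  have hp : HasPathIn G (f '' Set.Icc m n) (f i) (f j) (j - i) :=
    (HasPathIn.segment' hf hi hij.le hj).subset (Set.image_mono (Set.Icc_subset_Icc hi hj))
  have key : ∀ ℓ, HasPathIn G (f '' Set.Icc m n) (f i) (f j) ℓ → ℓ % 4 = (j - i) % 4 := by
    intro ℓ hℓ
    by_contra hne
    exact hcon ⟨_, _, hℓ, hp, hne⟩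
  refine (Models.of_list (q := thetaProblem ((j - i) % 4)) [m, n, k, i, j] hf ?_ ?_ ?_ ?_
    ?_).false_of_refute hG (refute_thetaProblem (Nat.mod_lt _ (by simp))) (by lia) rfl rfl ?_
  all_goals simp [thetaProblem]
  · exact ⟨⟨hm.symm, by lia⟩, hk, by lia⟩
  · refine ⟨fun ℓ hℓ => ?_, fun ℓ hℓ => ?_, fun ℓ hℓ => ?_⟩ <;> have := key ℓ hℓ <;> lia
  all_goals lia

/-- A path from `A` to `B` contains one with no further vertices in `A` or `B`. -/
theorem IsPathOn.exists_link (hg : IsPathOn G g 0 n) (h0 : g 0 ∈ A) (hn : g n ∈ B)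
    (hS : ∀ i ≤ n, g i ∈ S) : ∃ g n, IsPathOn G g 0 n ∧ g 0 ∈ A ∧ g n ∈ B ∧
      (∀ i ≤ n, g i ∈ S) ∧ (∀ i ≤ n, g i ∈ A → i = 0) ∧ ∀ i ≤ n, g i ∈ B → i = n := by
  classical
  have hex : ∃ n g, IsPathOn G g 0 n ∧ g 0 ∈ A ∧ g n ∈ B ∧ ∀ i ≤ n, g i ∈ S :=
    ⟨n, g, hg, h0, hn, hS⟩
  obtain ⟨g, hg, h0, hn, hS⟩ := Nat.find_spec hex
  have hmin := fun k => Nat.find_min' hex (m := k)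
  generalize Nat.find hex = n at *
  refine ⟨g, n, hg, h0, hn, hS, fun i hi hiA => ?_, fun i hi hiB => ?_⟩
  · have := hmin (n - i) ⟨g ∘ fun j => i + j, hg.comp (fun j hj => by lia)
      (fun _ _ _ _ _ => by lia) (fun j hj => hg.adj (i + j) (Nat.zero_le _) (by lia)), hiA,
      by simpa [hi] using hn, fun j hj => hS _ (by lia)⟩
    lia
  · have := hmin i ⟨g, hg.mono le_rfl hi, h0, hiB, fun j hj => hS j (by lia)⟩
    lia

theorem HasPathIn.pos_of_ne (h : HasPathIn G S x y k) (hxy : x ≠ y) : 0 < k := by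
  obtain ⟨p, -, rfl, -⟩ := h
  exact Nat.pos_of_ne_zero fun h => hxy (Walk.eq_of_length_eq_zero h)

end Cores

section Tails

variable {V : Type*} [Fintype V] [DecidableEq V] {G : SimpleGraph V} [DecidableRel G.Adj]
  {f : ℕ → V} {m N : ℕ}

/-- Some neighbour of the last vertex of an extremal path lies on the cycle. -/
theorem Extremal.exists_adj_last (h : Extremal G f m N) (hδ : ∀ v, 3 ≤ G.degree v)
    (hG : ∀ n, HasCycleLen G n → n % 4 ≠ 2)
    (hconn : ∀ u x y : V, x ≠ u → y ≠ u →
      ∃ g n, IsPathOn G g 0 n ∧ g 0 = x ∧ g n = y ∧ ∀ i ≤ n, g i ∈ ({u}ᶜ : Set V))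
    (hall : ∀ j ≤ N, G.Adj (f N) (f j) → m ≤ j) (hN : ∀ x, G.Adj (f N) x → ∃ j < N, x = f j) :
    False := by
  classical
  have hm := h.three_le hδ
  have hmN := h.le
  obtain ⟨k, j₁, hj₁, hj₁k, hkN, hadj₁, hadj₂⟩ : ∃ k j, m ≤ j ∧ j < k ∧ k + 1 < N ∧
      G.Adj (f N) (f j) ∧ G.Adj (f N) (f k) := by
    obtain ⟨x, hx, h1, -⟩ := exists_adj_ne_ne hδ (f N) (f (N - 1)) (f (N - 1))
    obtain ⟨i, hi, rfl⟩ := hN x hx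
    obtain ⟨y, hy, h2, h3⟩ := exists_adj_ne_ne hδ (f N) (f (N - 1)) (f i)
    obtain ⟨j, hj, rfl⟩ := hN y hy
    have hi1 : i ≠ N - 1 := fun e => h1 (e ▸ rfl)
    have hj1 : j ≠ N - 1 := fun e => h2 (e ▸ rfl)
    have hij : j ≠ i := fun e => h3 (e ▸ rfl)
    rcases hij.lt_or_gt with hij | hij
    · exact ⟨i, j, hall j hj.le hy, hij, by lia, hy, hx⟩
    · exact ⟨j, i, hall i hi.le hx, hij, by lia, hx, hy⟩
  let W : Set V → Prop := fun M =>
    f N ∈ M ∧ f j₁ ∈ M ∧ IsCore G M ∧ ∀ i ≤ m, f i ∈ M → i = m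
  obtain ⟨c, ⟨M, ⟨hNM, hjM, hcore, hMC⟩, rfl⟩, hmax⟩ := exists_max
    (P := fun c => ∃ M, W M ∧ M.ncard = c) (b := Fintype.card V)
    ⟨_, f '' Set.Icc j₁ N, ⟨⟨N, ⟨by lia, le_rfl⟩, rfl⟩, ⟨j₁, ⟨le_rfl, by lia⟩, rfl⟩,
      isCore_of_theta hG (h.path.mono (Nat.zero_le _) le_rfl) hj₁k hkN hadj₁ hadj₂, by
        rintro i hi ⟨j, ⟨hj, hj'⟩, he⟩
        rw [h.injOn_iff hj' (hi.trans h.le)] at he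
        lia⟩, rfl⟩ (by
      rintro _ ⟨M, -, rfl⟩
      rw [← Nat.card_eq_fintype_card]
      exact Set.ncard_le_card M)
  have hex : ∃ j, m ≤ j ∧ f j ∈ M := ⟨j₁, hj₁, hjM⟩
  obtain ⟨hmj, hjM'⟩ := Nat.find_spec hex
  have hjmin : ∀ i, m ≤ i → f i ∈ M → Nat.find hex ≤ i := fun i h1 h2 => Nat.find_min' hex ⟨h1, h2⟩
  have hjN : Nat.find hex < N := by
    have := hjmin j₁ hj₁ hjM
    lia
  generalize Nat.find hex = j at hmj hjM' hjmin hjN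
  have hinj : ∀ {i i'}, i ≤ N → i' ≤ N → f i = f i' → i = i' := fun h1 h2 =>
    (h.injOn_iff h1 h2).1
  have hMj : ∀ i ≤ j, f i ∈ M → i = j := by
    intro i hi hiM
    by_cases him : m ≤ i
    · exact le_antisymm hi (hjmin i him hiM)
    · have := hMC i (by lia) hiM
      lia
  obtain ⟨g₀, n₀, hg₀, h0, hn, hav⟩ := hconn (f j) (f N) (f 0)
    (fun e => hjN.ne' (hinj le_rfl hjN.le e)) (fun e => by
      have := hinj (Nat.zero_le _) hjN.le e
      lia)
  obtain ⟨g, n, hg, h0, hn, hav, hgM, hgj⟩ := hg₀.exists_link (A := M) (B := f '' Set.Iio j)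
    (by rwa [h0]) (by rw [hn]; exact ⟨0, by simp; lia, rfl⟩) hav
  obtain ⟨i, hij, hi⟩ := hn
  rw [Set.mem_Iio] at hij
  have hout : ∀ l < n, ∀ i ≤ j, g l ≠ f i := by
    intro l hl i' hi' he
    rcases hi'.lt_or_eq with hi' | rfl
    · exact hl.ne (hgj l hl.le ⟨i', hi', he.symm⟩)
    · exact hav l hl.le he
  have hn0 : 0 < n := by
    refine Nat.pos_of_ne_zero fun hn => ?_
    subst hn
    have := hMj i hij.le (hi ▸ h0)
    lia
  rcases lt_or_ge i m with him | him
  · have hne : f j ≠ g 0 := (hout 0 hn0 j le_rfl).symm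
    obtain ⟨k, l, hk, hl, hkl⟩ := hcore _ hjM' _ h0 hne
    have hpath : ∀ {k}, HasPathIn G M (f j) (g 0) k →
        HasPathIn G (f '' Set.Icc m j ∪ M ∪ g '' Set.Icc 0 n) (f m) (f i) (j - m + k + n) := by
      intro k hk
      have h1 := (HasPathIn.segment' h.path (Nat.zero_le m) hmj hjN.le).append hk (by
        rintro _ ⟨i, ⟨-, hi⟩, rfl⟩ hM
        rw [hMj i hi hM])
      have h2 := h1.append (HasPathIn.segment' hg le_rfl hn0.le le_rfl) (by
        rintro _ hx ⟨l, ⟨-, hl⟩, rfl⟩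
        rcases hx with ⟨i', ⟨hi1, hi2⟩, he⟩ | hx
        · exfalso
          rcases hl.lt_or_eq with hl | rfl
          · exact hout l hl i' hi2 he.symm
          · have := hinj (by lia) (by lia) (he.trans hi.symm)
            lia
        · rw [hgM l hl hx])
      rw [← hi] at h2
      simpa using h2
    have hS : ∀ x ∈ f '' Set.Icc m j ∪ M ∪ g '' Set.Icc 0 n, x ∈ f '' Set.Icc 0 m →
        x = f m ∨ x = f i := by
      rintro x hx ⟨i', ⟨-, hi'⟩, rfl⟩
      rcases hx with (⟨i'', ⟨h1, h2⟩, he⟩ | hx) | ⟨l, ⟨-, hl⟩, he⟩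
      · have := hinj (by lia) (by lia) he
        exact Or.inl (by rw [show i' = m by lia])
      · exact Or.inl (by rw [hMC i' hi' hx])
      · rcases hl.lt_or_eq with hl | rfl
        · exact absurd he (hout l hl i' (by lia))
        · exact Or.inr (he.symm.trans hi.symm)
    have := hk.pos_of_ne hne
    have := hl.pos_of_ne hne
    have hlast := hg.adj (n - 1) (Nat.zero_le _) (by lia)
    rw [show n - 1 + 1 = n by lia, ← hi] at hlast
    have := h.mod_eq hδ hG him hlast.symm (by
      rintro ⟨i', ⟨-, hi'⟩, he⟩
      exact hout (n - 1) (by lia) i' (by lia) he.symm) (hpath hk) (hpath hl) (by lia) (by lia) hS hS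
    lia
  · let e : ℕ → V := fun l => if l ≤ n then g l else f (i + (l - n))
    have he1 : ∀ l ≤ n, e l = g l := fun l hl => if_pos hl
    have he2 : ∀ l, n ≤ l → e l = f (i + (l - n)) := by
      intro l hl
      rcases hl.lt_or_eq with hl | rfl
      · exact if_neg (by lia)
      · rw [he1 _ le_rfl]
        simpa using hi.symm
    have he : IsPathOn G e 0 (n + (j - i)) := by
      refine ⟨?_, fun l _ hl => ?_⟩
      · have key : ∀ l l', l ≤ l' → l' ≤ n + (j - i) → e l = e l' → l = l' := by
          intro l l' hll hl' hee
          rcases le_or_gt l' n with h1 | h1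
          · rw [he1 _ h1, he1 _ (hll.trans h1)] at hee
            exact hg.injOn ⟨Nat.zero_le _, by lia⟩ ⟨Nat.zero_le _, h1⟩ hee
          · rw [he2 _ h1.le] at hee
            rcases lt_or_ge l n with h2 | h2
            · rw [he1 _ h2.le] at hee
              exact absurd hee (hout l h2 _ (by lia))
            · rw [he2 _ h2] at hee
              have := hinj (by lia) (by lia) hee
              lia
        rintro l ⟨-, hl⟩ l' ⟨-, hl'⟩ hee
        rcases le_total l l' with h | h
        · exact key l l' h hl' hee
        · exact (key l' l h hl hee.symm).symm
      · rcases lt_or_ge l n with h1 | h1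
        · rw [he1 _ h1.le, he1 _ h1]
          exact hg.adj l (Nat.zero_le _) h1
        · rw [he2 _ h1, he2 _ (by lia), show i + (l + 1 - n) = i + (l - n) + 1 by lia]
          exact h.path.adj _ (Nat.zero_le _) (by lia)
    have heM : ∀ l, 0 < l → l < n + (j - i) → e l ∉ M := by
      intro l h1 h2 hM
      rcases le_or_gt l n with h3 | h3
      · rw [he1 _ h3] at hM
        have := hgM l h3 hM
        lia
      · rw [he2 _ h3.le] at hM
        have := hMj _ (by lia) hM
        lia
    have hlt : M.ncard < (M ∪ e '' Set.Icc 0 (n + (j - i))).ncard := by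
      refine Set.ncard_lt_ncard ⟨Set.subset_union_left, fun hsub => ?_⟩ (Set.toFinite _)
      exact heM n hn0 (by lia) (hsub (Or.inr ⟨n, ⟨Nat.zero_le _, by lia⟩, rfl⟩))
    refine absurd (hmax _ ⟨_, ⟨Or.inl hNM, Or.inl hjM, hcore.union_ear he (by lia) ?_ ?_ heM, ?_⟩,
      rfl⟩) hlt.not_ge
    · rw [he1 0 (Nat.zero_le _)]
      exact h0
    · rw [he2 _ (by lia), show i + (n + (j - i) - n) = j by lia]
      exact hjM'
    · rintro i' hi' (hx | ⟨l, ⟨-, hl⟩, hx⟩)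
      · exact hMC i' hi' hx
      · rcases lt_or_ge l n with h1 | h1
        · rw [he1 _ h1.le] at hx
          exact absurd hx (hout l h1 i' (by lia))
        · rw [he2 _ h1] at hx
          have := hinj (by lia) (by lia) hx
          lia

end Tails

section Triples

variable {V : Type*} [Fintype V] [DecidableEq V] {G : SimpleGraph V} [DecidableRel G.Adj]
  {f : ℕ → V} {m N : ℕ}

open PathSearch

set_option maxHeartbeats 1000000 in
/-- The last vertex of an extremal path has at most one neighbour on the cycle besides the root. -/
theorem Extremal.not_adj_last (h : Extremal G f m N) (hδ : ∀ v, 3 ≤ G.degree v)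
    (hG : ∀ n, HasCycleLen G n → n % 4 ≠ 2) (hmN : m < N) {k l : ℕ} (hkl : k < l) (hlm : l < m)
    (hk : G.Adj (f N) (f k)) (hl : G.Adj (f N) (f l)) : False := by
  have hm := h.three_le hδ
  have hadj := fun j (hj : j < N) => h.path.adj j (Nat.zero_le _) hj
  have hlast : f N ∉ f '' Set.Icc 0 m := by
    rintro ⟨j, ⟨-, hj⟩, he⟩
    rw [h.injOn_iff (by lia) le_rfl] at he
    lia
  have notEnd : ∀ g, IsPathOn G g 0 N → (∀ j ≤ m, g j ∈ f '' Set.Icc 0 m) →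
      ¬ G.Adj (f N) (g 0) := fun g hg hg' h0 => hlast (h.exists_of_adj' hg hg' h0.symm)
  have hmem : ∀ {j}, j ≤ m → f j ∈ f '' Set.Icc 0 m := fun hj => ⟨_, ⟨Nat.zero_le _, hj⟩, rfl⟩
  have hr := h.path.rotate (by lia) h.le h.adj
  have hr' : ∀ j ≤ m, rotate f m j ∈ f '' Set.Icc 0 m := fun j => rotate_mem (by lia)
  have hr0 : ∀ j < m, rotate f m j = f (m - 1 - j) := fun j hj => by simp [rotate, hj]
  have hk0 : k ≠ 0 := by
    rintro rfl
    exact notEnd f h.path (fun j => hmem) hk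
  have hl1 : l ≠ m - 1 := by
    rintro rfl
    exact notEnd _ hr hr' (by rwa [hr0 0 (by lia)])
  obtain ⟨D, hD⟩ : ∃ D, D = N - m := ⟨_, rfl⟩
  let F : ℕ → V := f ∘ fun j => if j ≤ D then N - j else j - D - 1
  have hF : IsPathOn G F 0 N := by
    refine h.path.comp (fun j hj => by split_ifs <;> lia)
      (fun i hi j hj he => by split_ifs at he <;> lia) fun j hj => ?_
    rcases lt_trichotomy j D with h' | h' | h'
    · simp only [h'.le, show j + 1 ≤ D by lia, if_true]
      have := hadj (N - (j + 1)) (by lia)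
      rw [show N - (j + 1) + 1 = N - j by lia] at this
      exact this.symm
    · subst h'
      simp only [le_rfl, show ¬ j + 1 ≤ j by lia, if_true, if_false]
      rw [show N - j = m by lia, show j + 1 - j - 1 = 0 by lia]
      exact h.adj.symm
    · simp only [show ¬ j ≤ D by lia, show ¬ j + 1 ≤ D by lia, if_false]
      have := hadj (j - D - 1) (by lia)
      rwa [show j - D - 1 + 1 = j + 1 - D - 1 by lia] at this
  have hFf : ∀ i, F (D + 1 + i) = f i := fun i => by
    simp [F, show ¬ D + 1 + i ≤ D by lia, show D + 1 + i - D - 1 = i by lia]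
  have hF0 : F 0 = f N := by simp [F]
  have hFD : F D = f m := by simp [F, show N - D = m by lia]
  have hFN : F N = f (m - 1) := by rw [← hFf, show D + 1 + (m - 1) = N by lia]
  have hFC : ∀ x ∈ f '' Set.Icc 0 m, ∃ i, D ≤ i ∧ i ≤ N ∧ x = F i := by
    rintro _ ⟨i, ⟨-, hi⟩, rfl⟩
    rcases hi.lt_or_eq with hi | rfl
    · exact ⟨D + 1 + i, by lia, by lia, (hFf i).symm⟩
    · exact ⟨D, le_rfl, by lia, hFD.symm⟩
  have third : ∀ j g, IsPathOn G g 0 N → (∀ j ≤ m, g j ∈ f '' Set.Icc 0 m) → g 0 = F j →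
      ∃ i, D ≤ i ∧ i ≤ N ∧ G.Adj (F j) (F i) ∧ (j + 2 ≤ i ∨ i + 2 ≤ j) := by
    intro j g hg hg' h0
    obtain ⟨x, hx, h1, h2⟩ := exists_adj_ne_ne hδ (F j) (F (j - 1)) (F (j + 1))
    obtain ⟨i, hi, hi', rfl⟩ := hFC x (h.exists_of_adj' hg hg' (h0 ▸ hx))
    have hi1 : i ≠ j - 1 := fun e => h1 (e ▸ rfl)
    have hi2 : i ≠ j + 1 := fun e => h2 (e ▸ rfl)
    have hi3 : i ≠ j := by
      rintro rfl
      exact hx.ne rfl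
    exact ⟨i, hi, hi', hx, by lia⟩
  obtain ⟨e, he, heD, heN⟩ : ∃ e, G.Adj (F N) (F e) ∧ D < e ∧ e + 2 ≤ N := by
    obtain ⟨x, hx, h1, h2⟩ := exists_adj_ne_ne hδ (F N) (F (N - 1)) (F D)
    obtain ⟨i, hi, hi', rfl⟩ := hFC x (h.exists_of_adj' hr hr' (by
      rw [hr0 0 (by lia), Nat.sub_zero, ← hFN]
      exact hx))
    have hi1 : i ≠ N - 1 := fun e => h1 (e ▸ rfl)
    have hi2 : i ≠ D := fun e => h2 (e ▸ rfl)
    have hi3 : i ≠ N := by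
      rintro rfl
      exact hx.ne rfl
    exact ⟨i, hx, by lia, by lia⟩
  obtain ⟨a₁, ha₁, ha₁', ha₁adj, ha₁gap⟩ := third (D + 1) f h.path (fun j => hmem)
    (hFf 0).symm
  obtain ⟨i, rfl⟩ := Nat.exists_eq_add_of_lt heD
  have he' : G.Adj (f (m - 1)) (f i) := by
    rwa [hFN, show D + i + 1 = D + 1 + i by lia, hFf] at he
  have hs := hr.rotate (p := m - 1 - i) (by lia) (by lia) (by
    rw [hr0 0 (by lia), hr0 _ (by lia), show m - 1 - (m - 1 - i) = i by lia]
    exact he')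
  have hs0 : rotate (rotate f m) (m - 1 - i) 0 = f (i + 1) := by
    change rotate f m (if 0 < m - 1 - i then _ else _) = _
    rw [if_pos (by lia), hr0 _ (by lia)]
    congr 1
    lia
  have hs' : ∀ j ≤ m, rotate (rotate f m) (m - 1 - i) j ∈ f '' Set.Icc 0 m := by
    intro j hj
    obtain ⟨i, hi, hi'⟩ := rotate_mem (f := rotate f m) (p := m - 1 - i) (by lia) hj
    rw [← hi']
    exact hr' i hi.2
  have hik : i + 1 ≠ k := by
    rintro rfl
    exact notEnd _ hs hs' (by rwa [hs0])
  have hil : i + 1 ≠ l := by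
    rintro rfl
    exact notEnd _ hs hs' (by rwa [hs0])
  obtain ⟨a₂, ha₂, ha₂', ha₂adj, ha₂gap⟩ := third (D + i + 1 + 1) _ hs hs' (by
    rw [hs0, ← hFf, show D + 1 + (i + 1) = D + i + 1 + 1 by lia])
  obtain ⟨a₃, ha₃, ha₃', ha₃adj, ha₃gap⟩ := third (D + k)
    (f ∘ fun j => if j < k then k - 1 - j else if j ≤ m then m + k - j else N + m + 1 - j)
    (by
      refine h.path.comp (fun j hj => by split_ifs <;> lia)
        (fun i hi j hj he => by split_ifs at he <;> lia) fun j hj => ?_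
      have h1 : j + 1 < k ∨ j + 1 = k ∨ k ≤ j ∧ j < m ∨ j = m ∨ m < j := by lia
      rcases h1 with h1 | h1 | h1 | h1 | h1
      · simp only [show j < k by lia, h1, if_true]
        have := hadj (k - 1 - (j + 1)) (by lia)
        rw [show k - 1 - (j + 1) + 1 = k - 1 - j by lia] at this
        exact this.symm
      · simp only [show j < k by lia, show ¬ j + 1 < k by lia, show j + 1 ≤ m by lia, if_true,
          if_false]
        rw [show k - 1 - j = 0 by lia, show m + k - (j + 1) = m by lia]
        exact h.adj
      · simp only [show ¬ j < k by lia, show ¬ j + 1 < k by lia, show j + 1 ≤ m by lia,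
          show j ≤ m by lia, if_true, if_false]
        have := hadj (m + k - (j + 1)) (by lia)
        rw [show m + k - (j + 1) + 1 = m + k - j by lia] at this
        exact this.symm
      · simp only [show ¬ j < k by lia, show ¬ j + 1 < k by lia, show ¬ j + 1 ≤ m by lia,
          show j ≤ m by lia, if_true, if_false]
        rw [show m + k - j = k by lia, show N + m + 1 - (j + 1) = N by lia]
        exact hk.symm
      · simp only [show ¬ j < k by lia, show ¬ j + 1 < k by lia, show ¬ j + 1 ≤ m by lia,
          show ¬ j ≤ m by lia, if_false]
        have := hadj (N + m + 1 - (j + 1)) (by lia)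
        rw [show N + m + 1 - (j + 1) + 1 = N + m + 1 - j by lia] at this
        exact this.symm)
    (fun j hj => ⟨_, ⟨Nat.zero_le _, by beta_reduce; split_ifs <;> lia⟩, rfl⟩)
    (by
      rw [show D + k = D + 1 + (k - 1) by lia, hFf]
      simp [show 0 < k by lia])
  obtain ⟨a₄, ha₄, ha₄', ha₄adj, ha₄gap⟩ := third (D + 1 + l + 1)
    (f ∘ fun j => if j + l + 1 ≤ m then j + l + 1 else if j ≤ m then j - (m - l) else N + m + 1 - j)
    (by
      refine h.path.comp (fun j hj => by split_ifs <;> lia)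
        (fun i hi j hj he => by split_ifs at he <;> lia) fun j hj => ?_
      have h1 : j + 1 + l + 1 ≤ m ∨ j + l + 1 = m ∨ m < j + l + 1 ∧ j < m ∨ j = m ∨ m < j := by lia
      rcases h1 with h1 | h1 | h1 | h1 | h1
      · simp only [show j + l + 1 ≤ m by lia, h1, if_true]
        have := hadj (j + l + 1) (by lia)
        rwa [show j + l + 1 + 1 = j + 1 + l + 1 by lia] at this
      · simp only [show j + l + 1 ≤ m by lia, show ¬ j + 1 + l + 1 ≤ m by lia,
          show j + 1 ≤ m by lia, if_true, if_false]
        rw [h1, show j + 1 - (m - l) = 0 by lia]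
        exact h.adj.symm
      · simp only [show ¬ j + l + 1 ≤ m by lia, show ¬ j + 1 + l + 1 ≤ m by lia,
          show j + 1 ≤ m by lia, show j ≤ m by lia, if_true, if_false]
        have := hadj (j - (m - l)) (by lia)
        rwa [show j - (m - l) + 1 = j + 1 - (m - l) by lia] at this
      · simp only [show ¬ j + l + 1 ≤ m by lia, show ¬ j + 1 + l + 1 ≤ m by lia,
          show ¬ j + 1 ≤ m by lia, show j ≤ m by lia, if_true, if_false]
        rw [show j - (m - l) = l by lia, show N + m + 1 - (j + 1) = N by lia]
        exact hl.symm
      · simp only [show ¬ j + l + 1 ≤ m by lia, show ¬ j + 1 + l + 1 ≤ m by lia,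
          show ¬ j + 1 ≤ m by lia, show ¬ j ≤ m by lia, if_false]
        have := hadj (N + m + 1 - (j + 1)) (by lia)
        rw [show N + m + 1 - (j + 1) + 1 = N + m + 1 - j by lia] at this
        exact this.symm)
    (fun j hj => ⟨_, ⟨Nat.zero_le _, by beta_reduce; split_ifs <;> lia⟩, rfl⟩)
    (by
      rw [show D + 1 + l + 1 = D + 1 + (l + 1) by lia, hFf]
      simp [hlm])
  refine (Models.of_list (q := threeRootsProblem) [0, N, D, D + 1 + k, D + 1 + l, D + i + 1, D + 1,
    D + i + 1 + 1, a₁, a₂, D + k, a₃, D + 1 + l + 1, a₄] hF ?_ ?_ ?_ ?_ ?_).false_of_refute hG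
      refute_threeRootsProblem (by lia) rfl rfl ?_
  all_goals simp [threeRootsProblem]
  · rw [hF0, hFN, hFD, hFf, hFf]
    have := hadj (m - 1) (by lia)
    rw [show m - 1 + 1 = m by lia] at this
    exact ⟨⟨this, by lia⟩, ⟨hk, by lia⟩, ⟨hl, by lia⟩, ⟨hFN ▸ he, by lia⟩, ⟨ha₁adj, by lia⟩,
      ⟨ha₂adj, by lia⟩, ⟨ha₃adj, by lia⟩, ha₄adj, by lia⟩
  all_goals and_intros <;> lia

/-- An extremal path without cycles of length 2 mod 4 spans a cycle. -/
theorem Extremal.eq (h : Extremal G f m N) (hδ : ∀ v, 3 ≤ G.degree v)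
    (hG : ∀ n, HasCycleLen G n → n % 4 ≠ 2)
    (hconn : ∀ u x y : V, x ≠ u → y ≠ u →
      ∃ g n, IsPathOn G g 0 n ∧ g 0 = x ∧ g n = y ∧ ∀ i ≤ n, g i ∈ ({u}ᶜ : Set V)) : m = N := by
  by_contra hne
  have hmN : m < N := lt_of_le_of_ne h.le hne
  have hrev : IsPathOn G (f ∘ fun j => N - j) 0 N := by
    refine h.path.comp (fun j hj => by lia) (fun i hi j hj he => by lia) fun j hj => ?_
    have := h.path.adj (N - (j + 1)) (Nat.zero_le _) (by lia)
    rw [show N - (j + 1) + 1 = N - j by lia] at this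
    exact this.symm
  have hN : ∀ x, G.Adj (f N) x → ∃ j < N, x = f j := by
    intro x hx
    obtain ⟨k, hk, hk0, rfl⟩ := h.exists_of_adj hrev (by simpa using hx)
    exact ⟨N - k, by lia, rfl⟩
  have hinj : ∀ {i i'}, i ≤ N → i' ≤ N → f i = f i' → i = i' := fun h1 h2 =>
    (h.injOn_iff h1 h2).1
  by_cases hall : ∀ j ≤ N, G.Adj (f N) (f j) → m ≤ j
  · exact h.exists_adj_last hδ hG hconn hall hN
  push Not at hall
  obtain ⟨k, hkN, hk, hkm⟩ := hall
  have hlast : f N ∉ f '' Set.Icc 0 m := by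
    rintro ⟨j, ⟨-, hj⟩, he⟩
    have := hinj (by lia) le_rfl he
    lia
  have htail : ∀ j, m ≤ j → j + 1 < N → ¬ G.Adj (f N) (f j) := by
    intro j hj hjN hadj
    have hC : ∀ {i i'}, m ≤ i' → i' ≤ N → i ≤ m → f i' = f i → f i = f m := by
      intro i i' h1 h2 h3 he
      have := hinj h2 (by lia) he
      rw [show i = m by lia]
    have h1 := (HasPathIn.segment' h.path (Nat.zero_le m) h.le le_rfl).concat hk (by
      rintro ⟨i, ⟨hi, hi'⟩, he⟩
      have := hinj hi' hkN he
      lia)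
    have h2 := ((HasPathIn.segment' h.path (Nat.zero_le m) hj (by lia)).concat hadj.symm (by
      rintro ⟨i, ⟨hi, hi'⟩, he⟩
      have := hinj (by lia) le_rfl he
      lia)).concat hk (by
      rintro (he | ⟨i, ⟨hi, hi'⟩, he⟩)
      · have := hinj (by lia) le_rfl he
        lia
      · have := hinj (by lia) hkN he
        lia)
    have h3 := h.mod_eq hδ hG hkm hk.symm hlast h1 h2 (by lia) (by lia) (by
        rintro x hx ⟨i', ⟨-, hi''⟩, rfl⟩
        rcases hx with hx | ⟨i, ⟨hi, hi'⟩, he⟩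
        · exact Or.inr hx
        · exact Or.inl (hC hi hi' hi'' he)) (by
        rintro x hx ⟨i', ⟨-, hi''⟩, rfl⟩
        rcases hx with hx | hx | ⟨i, ⟨hi, hi'⟩, he⟩
        · exact Or.inr hx
        · exact absurd ⟨i', ⟨Nat.zero_le _, hi''⟩, hx⟩ hlast
        · exact Or.inl (hC hi (by lia) hi'' he))
    have := hG _ ((HasPathIn.segment' h.path (Nat.zero_le j) (by lia) le_rfl).hasCycleLen
      hadj.symm (by lia))
    lia
  obtain ⟨x, hx, h1, h2⟩ := exists_adj_ne_ne hδ (f N) (f (N - 1)) (f k)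
  obtain ⟨l, hl, rfl⟩ := hN x hx
  have hl1 : l ≠ N - 1 := fun e => h1 (e ▸ rfl)
  have hlk : l ≠ k := fun e => h2 (e ▸ rfl)
  have hlm : l < m := by
    by_contra! hlm
    exact htail l hlm (by lia) hx
  rcases hlk.lt_or_gt with hlk | hlk
  · exact h.not_adj_last hδ hG hmN hlk hkm hx hk
  · exact h.not_adj_last hδ hG hmN hlk hlm hk hx

end Triples

section HamiltonianCycles

variable {V : Type*} {G : SimpleGraph V} {f g : ℕ → V} {e : ℕ}

/-- The path obtained by cutting a cycle at position `i`. -/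
theorem IsPathOn.shift (hf : IsPathOn G f 0 e) (h : G.Adj (f 0) (f e)) {i : ℕ} (hi : i ≤ e) :
    IsPathOn G (f ∘ fun j => if j + i ≤ e then j + i else j + i - (e + 1)) 0 e := by
  refine hf.comp (fun j hj => by split_ifs <;> lia)
    (fun i hi j hj h => by split_ifs at h <;> lia) fun j hj => ?_
  rcases lt_trichotomy (j + i) e with h' | h' | h'
  · simp only [h'.le, show j + i + 1 ≤ e by lia, if_true, show j + 1 + i = j + i + 1 by lia]
    exact hf.adj _ (Nat.zero_le _) h'
  · simp only [h', le_rfl, show ¬ j + 1 + i ≤ e by lia, if_true, if_false,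
      show j + 1 + i - (e + 1) = 0 by lia]
    exact h.symm
  · simp only [show ¬ j + i ≤ e by lia, show ¬ j + 1 + i ≤ e by lia, if_false,
      show j + 1 + i - (e + 1) = j + i - (e + 1) + 1 by lia]
    exact hf.adj _ (Nat.zero_le _) (by lia)

variable [Fintype V]

/-- An extremal path spanning a cycle is Hamiltonian. -/
theorem Extremal.card_eq (h : Extremal G f e e)
    (hconn : ∀ u x y : V, x ≠ u → y ≠ u →
      ∃ g n, IsPathOn G g 0 n ∧ g 0 = x ∧ g n = y ∧ ∀ i ≤ n, g i ∈ ({u}ᶜ : Set V)) :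
    Fintype.card V = e + 1 := by
  have hadj : ∀ x ∈ f '' Set.Icc 0 e, ∀ y, G.Adj x y → y ∈ f '' Set.Icc 0 e := by
    rintro _ ⟨i, ⟨-, hi⟩, rfl⟩ y hy
    obtain ⟨k, hk, -, rfl⟩ := h.exists_of_adj (h.path.shift h.adj hi) (x := y) (by simpa [hi])
    exact ⟨_, ⟨Nat.zero_le _, by beta_reduce; split_ifs <;> lia⟩, rfl⟩
  have he : e ≠ 0 := by
    rintro rfl
    exact h.adj.ne rfl
  have hsurj : ∀ x, x ∈ f '' Set.Icc 0 e := by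
    intro x
    by_contra hx
    have h0 : f 0 ≠ f e := h.adj.ne
    have hxe : x ≠ f e := by
      rintro rfl
      exact hx ⟨e, ⟨Nat.zero_le _, le_rfl⟩, rfl⟩
    obtain ⟨g, n, hg, hg0, rfl, -⟩ := hconn (f e) (f 0) x h0 hxe
    have : ∀ i ≤ n, g i ∈ f '' Set.Icc 0 e := by
      intro i
      induction i with
      | zero => exact fun _ => hg0 ▸ ⟨0, ⟨le_rfl, Nat.zero_le _⟩, rfl⟩
      | succ i ih => exact fun hi => hadj _ (ih (by lia)) _ (hg.adj i (Nat.zero_le _) hi)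
    exact hx (this n le_rfl)
  have : Function.Bijective fun i : Fin (e + 1) => f i := by
    refine ⟨fun i j hij => Fin.ext ((h.injOn_iff (by lia) (by lia)).1 hij), fun x => ?_⟩
    obtain ⟨i, ⟨-, hi⟩, rfl⟩ := hsurj x
    exact ⟨⟨i, by lia⟩, rfl⟩
  simpa using (Fintype.card_of_bijective this).symm

open PathSearch

/-- A Hamiltonian graph of minimum degree at least 3 with at least 6 vertices has a cycle of length
2 mod 4. -/
theorem IsPathOn.exists_hasCycleLen [DecidableEq V] [DecidableRel G.Adj] (hf : IsPathOn G f 0 e)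
    (hadj : G.Adj (f 0) (f e)) (hcard : Fintype.card V = e + 1) (he : 5 ≤ e)
    (hδ : ∀ v, 3 ≤ G.degree v) : ∃ n, HasCycleLen G n ∧ n % 4 = 2 := by
  classical
  by_contra! hG
  have third : ∀ g, IsPathOn G g 0 e → ∀ k a b, ∃ i ≤ e, G.Adj (g k) (g i) ∧ i ≠ k ∧ i ≠ a ∧
      i ≠ b := by
    intro g hg k a b
    obtain ⟨x, hx, h1, h2⟩ := exists_adj_ne_ne hδ (g k) (g a) (g b)
    have hbij : Function.Bijective fun i : Fin (e + 1) => g i := by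
      rw [Fintype.bijective_iff_injective_and_card]
      exact ⟨fun i j hij => Fin.ext (hg.injOn ⟨Nat.zero_le _, by lia⟩ ⟨Nat.zero_le _, by lia⟩ hij),
        by simp [hcard]⟩
    obtain ⟨i, rfl⟩ := hbij.2 x
    exact ⟨i, by lia, hx, fun h => hx.ne (by simp [h]), fun h => h1 (by simp [h]),
      fun h => h2 (by simp [h])⟩
  have hP : ∃ b, ∃ g, IsPathOn G g 0 e ∧ G.Adj (g 0) (g e) ∧ G.Adj (g 0) (g b) ∧ 2 ≤ b ∧ b < e := by
    obtain ⟨i, hi, hi', h0, h1, h2⟩ := third f hf 0 1 e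
    exact ⟨i, f, hf, hadj, hi', by lia, by lia⟩
  obtain ⟨g, hg, hge, hgb, hb, hbe⟩ := Nat.find_spec hP
  have hmin := fun c => Nat.find_min' hP (m := c)
  generalize Nat.find hP = b at hgb hb hbe hmin
  have chord : ∀ i j, i + 2 ≤ j → j ≤ e → (i ≠ 0 ∨ j ≠ e) → G.Adj (g i) (g j) → i + b ≤ j := by
    intro i j hij hj hne h
    have := hmin (j - i) ⟨_, hg.shift hge (show i ≤ e by lia), ?_, ?_, by lia, by lia⟩
    · lia
    · rcases Nat.eq_zero_or_pos i with rfl | hi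
      · simpa using hge
      · simp only [Function.comp, Nat.zero_add, show i ≤ e by lia, if_true,
          show ¬ e + i ≤ e by lia, if_false]
        have := hg.adj (i - 1) (Nat.zero_le _) (by lia)
        rw [show i - 1 + 1 = i by lia] at this
        rw [show e + i - (e + 1) = i - 1 by lia]
        exact this.symm
    · simpa [show i ≤ e by lia, show j - i + i = j by lia, hj] using h
  obtain ⟨y₁, hy₁, hy₁adj, h11, h10, h12⟩ := third g hg 1 0 2
  have hy₁b := chord 1 y₁ (by lia) hy₁ (by lia) hy₁adj
  rcases hb.lt_or_eq with hb2 | rfl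
  · obtain ⟨y₂, hy₂, hy₂adj, h22, h21, h23⟩ := third g hg 2 1 3
    have hy₂0 : y₂ ≠ 0 := by
      rintro rfl
      have := chord 0 2 le_rfl (by lia) (by lia) hy₂adj.symm
      lia
    have hy₂b := chord 2 y₂ (by lia) hy₂ (by lia) hy₂adj
    rcases Nat.lt_or_eq_of_le (show 3 ≤ b from hb2) with hb3 | rfl
    · obtain ⟨y, hy, hyadj, hy0, hy1, hy2⟩ := third g hg (b - 1) (b - 2) b
      have hyb : b < y := by
        by_contra! hyb
        have := chord y (b - 1) (by lia) (by lia) (by lia) hyadj.symm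
        lia
      refine (Models.of_list (q := longChordProblem) [0, e, b, 1, 2, y₁, y₂, b - 1, y] hg
        ?_ ?_ ?_ ?_ ?_).false_of_refute hG refute_longChordProblem (by lia) rfl rfl ?_
      all_goals simp [longChordProblem]
      · exact ⟨⟨hge, by lia⟩, ⟨hgb, by lia⟩, ⟨hy₁adj, by lia⟩, ⟨hyadj, by lia⟩, hy₂adj, by lia⟩
      all_goals and_intros <;> lia
    · obtain ⟨y₄, hy₄, hy₄adj, h44, h43, h45⟩ := third g hg 4 3 5
      obtain ⟨y₅, hy₅, hy₅adj, h55, h54, h56⟩ := third g hg 5 4 6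
      refine (Models.of_list (q := threeChordProblem) [0, e, 1, 2, 3, y₁, 4, y₂, y₄, 5, y₅] hg
        ?_ ?_ ?_ ?_ ?_).false_of_refute hG refute_threeChordProblem (by lia) rfl rfl ?_
      all_goals simp [threeChordProblem]
      · exact ⟨⟨hge, by lia⟩, hgb, ⟨hy₁adj, by lia⟩, ⟨hy₂adj, by lia⟩, ⟨hy₄adj, by lia⟩,
          hy₅adj, by lia⟩
      all_goals and_intros <;> lia
  · obtain ⟨y₃, hy₃, hy₃adj, h33, h32, h34⟩ := third g hg 3 2 4
    obtain ⟨y₄, hy₄, hy₄adj, h44, h43, h45⟩ := third g hg 4 3 5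
    obtain ⟨y₅, hy₅, hy₅adj, h55, h54, h56⟩ := third g hg 5 4 6
    obtain ⟨y, hy, hyadj, hy0, hy1, hy2⟩ := third g hg (e - 1) (e - 2) e
    obtain ⟨z, hz, hzadj, hz0, hz1, hz2⟩ := third g hg e (e - 1) 0
    refine (Models.of_list (q := twoChordProblem) [0, e, 1, 2, y₁, e - 1, y, 3, y₃, 4, y₄, 5, y₅, z]
      hg ?_ ?_ ?_ ?_ ?_).false_of_refute hG refute_twoChordProblem (by lia) rfl rfl ?_
    all_goals simp [twoChordProblem]
    · exact ⟨⟨hge, by lia⟩, hgb, ⟨hy₁adj, by lia⟩, ⟨hy₃adj, by lia⟩, ⟨hyadj, by lia⟩,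
        ⟨hzadj, by lia⟩, ⟨hy₄adj, by lia⟩, hy₅adj, by lia⟩
    all_goals and_intros <;> lia

theorem KConnected.exists_isPathOn (h : KConnected G 2) {u x y : V} (hx : x ≠ u) (hy : y ≠ u) :
    ∃ g n, IsPathOn G g 0 n ∧ g 0 = x ∧ g n = y ∧ ∀ i ≤ n, g i ∈ ({u}ᶜ : Set V) := by
  have hc := h.2 {u} (by simp)
  obtain ⟨p, hp⟩ := (hc.preconnected ⟨x, by simpa⟩ ⟨y, by simpa⟩).exists_isPath
  refine ⟨fun i => p.getVert i, p.length, ⟨?_, ?_⟩, by simp, by simp, fun i _ => ?_⟩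
  · intro i hi j hj hij
    exact hp.getVert_injOn hi.2 hj.2 (Subtype.ext hij)
  · exact fun i _ hi => p.adj_getVert_succ hi
  · simpa using (p.getVert i).2

end HamiltonianCycles

/-- Every 2-connected graph with at least 6 vertices and minimum
degree at least 3 contains a cycle whose length is congruent to 2 modulo 4. -/
theorem stmt16 {V : Type*} [Fintype V] [DecidableEq V] (G : SimpleGraph V)
    [DecidableRel G.Adj] (hcard : 6 ≤ Fintype.card V)
    (h2 : KConnected G 2) (hδ : ∀ v : V, 3 ≤ G.degree v) :
    ∃ n : ℕ, HasCycleLen G n ∧ n % 4 = 2 := by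
  by_contra! hG
  have : Nonempty V := Fintype.card_pos_iff.1 (by lia)
  obtain ⟨f, m, N, h⟩ := exists_extremal fun v =>
    (exists_adj_ne_ne hδ v v v).imp fun _ hw => hw.1
  have hconn := fun u x y (hx : x ≠ u) (hy : y ≠ u) => h2.exists_isPathOn hx hy
  obtain rfl := h.eq hδ hG hconn
  have hN := h.card_eq hconn
  obtain ⟨n, hn, hn'⟩ := h.path.exists_hasCycleLen h.adj hN (by lia) hδ
  exact hG n hn hn'
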